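/- arXiv:2201.10112 — 2 statements merged into one kernel-verified Lean document; each statement's English description precedes it below -/
import Mathlib

section
/- Let n ≥ 1, c, H > 0 and b, m² ≥ 0 with b² ≥ 4m². Let β ≥ 0, p > 1, r = r_crit(b,m²,β,p) := (1/2)(b − √(b²−4m²))((β+1)p − 1), and κ > κ_crit(b,m²,β,p), where κ_crit := −1 if b² > 4m² and κ_crit := −1 − (β+1)p if b² = 4m². Take Γ(t) = μ e^{r_crit t}(1+t)^κ with μ > 0. Assume u₀, u₁ ∈ L¹_loc(ℝⁿ) are nonnegative, nontrivial, and supported in B_R for some R > 0, and let u be a weak solution of the de Sitter problem with lifespan T(ε). Then there exists ε₀ > 0 such that for every ε ∈ (0, ε₀] the solution u blows up in finite time, and T(ε) ≤ C ε^{−((β+1)p−1)/(κ+1)} if b² > 4m², while T(ε) ≤ C ε^{−( (κ+2)/((β+1)p−1) + 1 )^{−1}} if b² = 4m², where C > 0 is independent of ε. -/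
open MeasureTheory Real Set

noncomputable section

/-- `ℝⁿ` as a Euclidean space. -/
abbrev Eucl (n : ℕ) := EuclideanSpace ℝ (Fin n)

/-- The Laplace operator on functions `ℝⁿ → ℝ`, written as the sum of the second-order
partial derivatives in the coordinate directions. -/
def lapl {n : ℕ} (f : Eucl n → ℝ) (x : Eucl n) : ℝ :=
  ∑ i : Fin n,
    fderiv ℝ (fun y => fderiv ℝ f y (EuclideanSpace.single i 1)) x (EuclideanSpace.single i 1)

/-- A test function `φ ∈ C_0^∞([0,T) × ℝⁿ)`: smooth, compactly supported, with support
contained in `[0,T') × ℝⁿ` for some `T' < T`. -/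
structure IsTestFn {n : ℕ} (T : ℝ) (φ : ℝ → Eucl n → ℝ) : Prop where
  smooth : ContDiff ℝ (⊤ : ℕ∞) (fun q : ℝ × Eucl n => φ q.1 q.2)
  cpt : HasCompactSupport (fun q : ℝ × Eucl n => φ q.1 q.2)
  vanish : ∃ T' : ℝ, T' < T ∧ ∀ s ≥ T', ∀ x, φ s x = 0

/-- Weak solution (with `C¹` regularity in time) on `[0,T)` of the semilinear wave equation
in de Sitter spacetime
`∂_t²u − c²e^{−2Ht}Δu + b ∂_t u + m²u = Γ(t) (∫ |u(t,y)|^p dy)^β |u|^p`,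
with data `u(0,·) = ε u₀`, `∂_t u(0,·) = ε u₁` supported in `B_R`.
Here `ut` denotes the time derivative `∂_t u`. -/
structure IsWeakSolDS (n : ℕ) (c H b m2 p β : ℝ) (Γ : ℝ → ℝ) (ε : ℝ)
    (u0 u1 : Eucl n → ℝ) (R T : ℝ) (u ut : ℝ → Eucl n → ℝ) : Prop where
  /-- `u(t,·) ∈ L¹_loc`: by the support condition it is in fact integrable. -/
  integ_u : ∀ t ∈ Ico (0:ℝ) T, Integrable (u t)
  integ_ut : ∀ t ∈ Ico (0:ℝ) T, Integrable (ut t)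
  integ_pow : ∀ t ∈ Ico (0:ℝ) T, Integrable (fun x => |u t x| ^ p)
  /-- `u ∈ C¹([0,T), L¹_loc(ℝⁿ))`, tested against continuous compactly supported functions:
  `ut` is the time derivative of `u` and is continuous in time. -/
  c1 : ∀ g : Eucl n → ℝ, Continuous g → HasCompactSupport g →
      (∀ t ∈ Ico (0:ℝ) T,
        HasDerivWithinAt (fun s => ∫ x, u s x * g x) (∫ x, ut t x * g x) (Ico (0:ℝ) T) t) ∧
      ContinuousOn (fun t => ∫ x, ut t x * g x) (Ico (0:ℝ) T)
  /-- `f(t,u) ∈ L¹_loc((0,T) × ℝⁿ)`. -/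
  nonlin_L1loc : ∀ t ∈ Ico (0:ℝ) T,
      IntervalIntegrable (fun s => Γ s * (∫ y, |u s y| ^ p) ^ β * ∫ x, |u s x| ^ p) volume 0 t
  /-- support condition: `supp u(t,·) ⊆ B_{R + (c/H)(1 − e^{−Ht})}`. -/
  supp : ∀ t ∈ Ioo (0:ℝ) T, ∀ x, u t x ≠ 0 → ‖x‖ ≤ R + (c / H) * (1 - exp (-(H * t)))
  /-- the weak formulation of the equation. -/
  identity : ∀ t ∈ Ioo (0:ℝ) T, ∀ φ : ℝ → Eucl n → ℝ, IsTestFn T φ →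
      (∫ x, ut t x * φ t x) - (∫ x, u t x * deriv (fun s => φ s x) t)
        + b * (∫ x, u t x * φ t x)
        + (∫ s in (0:ℝ)..t, ∫ x, u s x *
            (deriv (deriv (fun r => φ r x)) s
              - c ^ 2 * exp (-(2 * H * s)) * lapl (fun y => φ s y) x
              - b * deriv (fun r => φ r x) s + m2 * φ s x))
      = ε * (∫ x, u1 x * φ 0 x)
        + ε * (∫ x, u0 x * (b * φ 0 x - deriv (fun s => φ s x) 0))
        + (∫ s in (0:ℝ)..t, Γ s * (∫ y, |u s y| ^ p) ^ β * (∫ x, |u s x| ^ p * φ s x))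


lemma lapl_zero_of_eventually_const {n : ℕ} (f : Eucl n → ℝ) (x : Eucl n) (k : ℝ)
    (h : f =ᶠ[nhds x] fun _ => k) : lapl f x = 0 := by
  unfold lapl
  refine Finset.sum_eq_zero (fun i _ => ?_)
  have h1 : (fun y => fderiv ℝ f y (EuclideanSpace.single i 1)) =ᶠ[nhds x] fun _ => (0:ℝ) := by
    filter_upwards [h.fderiv (𝕜 := ℝ)] with y hy
    rw [hy]; simp
  rw [h1.fderiv_eq]; simp

/-- the spatial cutoff -/
def cutoff (n : ℕ) (ρ : ℝ) (hρ : 0 < ρ) : ContDiffBump (0 : Eucl n) :=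
  ⟨ρ + 1, ρ + 2, by linarith, by linarith⟩

lemma cutoff_eventually {n : ℕ} (ρ : ℝ) (hρ : 0 < ρ) (x : Eucl n) (hx : ‖x‖ ≤ ρ) :
    (cutoff n ρ hρ : Eucl n → ℝ) =ᶠ[nhds x] fun _ => 1 := by
  have : Metric.ball (0 : Eucl n) (ρ + 1) ∈ nhds x :=
    Metric.isOpen_ball.mem_nhds (by simp; linarith)
  filter_upwards [this] with y hy
  exact ContDiffBump.one_of_mem_closedBall _ (Metric.ball_subset_closedBall hy)

lemma weak_id (n : ℕ) (c H b m2 β p ε R T ρ : ℝ) (Γ : ℝ → ℝ)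
    (hc : 0 < c) (hH : 0 < H) (hp : 1 < p) (hρ : 0 < ρ) (hρR : ρ = R + c / H) 
    (u0 u1 : Eucl n → ℝ)
    (hu0s : ∀ x, u0 x ≠ 0 → ‖x‖ ≤ R) (hu1s : ∀ x, u1 x ≠ 0 → ‖x‖ ≤ R)
    (u ut : ℝ → Eucl n → ℝ) (hw : IsWeakSolDS n c H b m2 p β Γ ε u0 u1 R T u ut)
    (h h1 h2 : ℝ → ℝ) (hsm : ContDiff ℝ (⊤ : ℕ∞) h) (hd1 : ∀ s, HasDerivAt h (h1 s) s)
    (hd2 : ∀ s, HasDerivAt h1 (h2 s) s) (t : ℝ) (ht : t ∈ Ioo (0:ℝ) T) :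
    (∫ x, ut t x * cutoff n ρ hρ x) * h t - (∫ x, u t x * cutoff n ρ hρ x) * h1 t
      + b * ((∫ x, u t x * cutoff n ρ hρ x) * h t)
      + (∫ s in (0:ℝ)..t, (h2 s - b * h1 s + m2 * h s) * ∫ x, u s x * cutoff n ρ hρ x)
    = ε * (h 0 * ∫ x, u1 x) + ε * ((b * h 0 - h1 0) * ∫ x, u0 x)
      + ∫ s in (0:ℝ)..t, h s * (Γ s * (∫ y, |u s y| ^ p) ^ β * ∫ x, |u s x| ^ p) := by
  have hcH : 0 < c / H := by positivity
  have ht0 := ht.1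
  have htT := ht.2
  let χ : ContDiffBump (0:ℝ) := ⟨(2 * t + T) / 3, (t + 2 * T) / 3, by linarith, by linarith⟩
  let ψ := cutoff n ρ hρ
  have hψs : ContDiff ℝ (⊤ : ℕ∞) (ψ : Eucl n → ℝ) := ψ.contDiff
  have hχs : ContDiff ℝ (⊤ : ℕ∞) (χ : ℝ → ℝ) := χ.contDiff
  have hχ1 : ∀ s ∈ Icc (0:ℝ) t, (χ : ℝ → ℝ) =ᶠ[nhds s] fun _ => 1 := by
    intro s hs
    have : Metric.ball (0 : ℝ) ((2 * t + T) / 3) ∈ nhds s :=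
      Metric.isOpen_ball.mem_nhds (by simp [abs_of_nonneg hs.1]; linarith [hs.2])
    filter_upwards [this] with y hy
    exact ContDiffBump.one_of_mem_closedBall _ (Metric.ball_subset_closedBall hy)
  have hψ1 : ∀ x : Eucl n, ‖x‖ ≤ ρ → ψ x = 1 := fun x hx => (cutoff_eventually ρ hρ x hx).self_of_nhds
  have husupp : ∀ s ∈ Ioc (0:ℝ) t, ∀ x, u s x ≠ 0 → ‖x‖ ≤ ρ := by
    intro s hs x hx
    refine (hw.supp s ⟨hs.1, hs.2.trans_lt htT⟩ x hx).trans ?_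
    rw [hρR]
    nlinarith [exp_pos (-(H * s))]
  let φ : ℝ → Eucl n → ℝ := fun s x => h s * χ s * ψ x
  have hφ : IsTestFn T φ := by
    refine ⟨?_, ?_, ?_⟩
    · exact ((hsm.comp contDiff_fst).mul (hχs.comp contDiff_fst)).mul (hψs.comp contDiff_snd)
    · refine HasCompactSupport.intro' (K := Metric.closedBall (0:ℝ) ((t + 2 * T) / 3) ×ˢ Metric.closedBall (0 : Eucl n) (ρ + 2)) ((isCompact_closedBall _ _).prod (isCompact_closedBall _ _)) (Metric.isClosed_closedBall.prod Metric.isClosed_closedBall) ?_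
      rintro ⟨s, x⟩ hsx
      simp only [mem_prod, not_and_or] at hsx
      rcases hsx with hs | hx
      · have : χ s = 0 := χ.zero_of_le_dist (by simp only [Metric.mem_closedBall, not_le] at hs; exact hs.le)
        simp [φ, this]
      · have : ψ x = 0 := ψ.zero_of_le_dist (by simp only [Metric.mem_closedBall, not_le] at hx; exact hx.le)
        simp [φ, this]
    · refine ⟨(t + 2 * T) / 3, by linarith, fun s hs x => ?_⟩
      have : χ s = 0 := χ.zero_of_le_dist (by
        rw [Real.dist_eq, sub_zero]; exact le_trans hs (le_abs_self s))
      simp [φ, this]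
  have hφe : ∀ s ∈ Icc (0:ℝ) t, ∀ x, (fun r => φ r x) =ᶠ[nhds s] fun r => h r * ψ x := by
    intro s hs x
    filter_upwards [hχ1 s hs] with r hr
    simp [φ, hr]
  have hφv : ∀ s ∈ Icc (0:ℝ) t, ∀ x, φ s x = h s * ψ x := fun s hs x => (hφe s hs x).self_of_nhds
  have hdd : ∀ x, deriv (fun r => h r * ψ x) = fun r => h1 r * ψ x := by
    intro x; funext r; exact ((hd1 r).mul_const _).deriv
  have hφd : ∀ s ∈ Icc (0:ℝ) t, ∀ x, deriv (fun r => φ r x) s = h1 s * ψ x := by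
    intro s hs x
    rw [(hφe s hs x).deriv_eq, hdd]
  have hφdd : ∀ s ∈ Icc (0:ℝ) t, ∀ x, deriv (deriv (fun r => φ r x)) s = h2 s * ψ x := by
    intro s hs x
    rw [(hφe s hs x).deriv.deriv_eq, hdd]
    exact ((hd2 s).mul_const _).deriv
  have hφl : ∀ s, ∀ x : Eucl n, ‖x‖ ≤ ρ → lapl (fun y => φ s y) x = 0 := by
    intro s x hx
    refine lapl_zero_of_eventually_const _ x (h s * χ s) ?_
    filter_upwards [cutoff_eventually ρ hρ x hx] with y hy
    have : ψ y = 1 := hy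
    simp [φ, this]
  have key := hw.identity t ht φ hφ
  have htI : t ∈ Icc (0:ℝ) t := ⟨ht0.le, le_rfl⟩
  have h0I : (0:ℝ) ∈ Icc (0:ℝ) t := ⟨le_rfl, ht0.le⟩
  have T1 : ∫ x, ut t x * φ t x = (∫ x, ut t x * ψ x) * h t := by
    rw [← integral_mul_const]; congr 1; funext x; rw [hφv t htI]; ring
  have T2 : ∫ x, u t x * deriv (fun s => φ s x) t = (∫ x, u t x * ψ x) * h1 t := by
    rw [← integral_mul_const]; congr 1; funext x; rw [hφd t htI]; ring
  have T3 : ∫ x, u t x * φ t x = (∫ x, u t x * ψ x) * h t := by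
    rw [← integral_mul_const]; congr 1; funext x; rw [hφv t htI]; ring
  have T4 : (∫ s in (0:ℝ)..t, ∫ x, u s x *
            (deriv (deriv (fun r => φ r x)) s
              - c ^ 2 * exp (-(2 * H * s)) * lapl (fun y => φ s y) x
              - b * deriv (fun r => φ r x) s + m2 * φ s x))
      = ∫ s in (0:ℝ)..t, (h2 s - b * h1 s + m2 * h s) * ∫ x, u s x * ψ x := by
    rw [intervalIntegral.integral_of_le ht0.le, intervalIntegral.integral_of_le ht0.le]
    refine setIntegral_congr_fun measurableSet_Ioc (fun s hs => ?_)
    rw [← integral_const_mul]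
    congr 1; funext x
    by_cases hx : u s x = 0
    · simp [hx]
    · have hs' : s ∈ Icc (0:ℝ) t := ⟨hs.1.le, hs.2⟩
      rw [hφl s x (husupp s hs x hx), hφv s hs', hφd s hs', hφdd s hs']; ring
  have T5 : ∫ x, u1 x * φ 0 x = h 0 * ∫ x, u1 x := by
    rw [← integral_const_mul]; congr 1; funext x
    by_cases hx : u1 x = 0
    · simp [hx]
    · rw [hφv 0 h0I, hψ1 x (by linarith [hu1s x hx])]; ring
  have T6 : ∫ x, u0 x * (b * φ 0 x - deriv (fun s => φ s x) 0) = (b * h 0 - h1 0) * ∫ x, u0 x := by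
    rw [← integral_const_mul]; congr 1; funext x
    by_cases hx : u0 x = 0
    · simp [hx]
    · rw [hφv 0 h0I, hφd 0 h0I, hψ1 x (by linarith [hu0s x hx])]; ring
  have T7 : (∫ s in (0:ℝ)..t, Γ s * (∫ y, |u s y| ^ p) ^ β * (∫ x, |u s x| ^ p * φ s x))
      = ∫ s in (0:ℝ)..t, h s * (Γ s * (∫ y, |u s y| ^ p) ^ β * ∫ x, |u s x| ^ p) := by
    rw [intervalIntegral.integral_of_le ht0.le, intervalIntegral.integral_of_le ht0.le]
    refine setIntegral_congr_fun measurableSet_Ioc (fun s hs => ?_)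
    have : ∫ x, |u s x| ^ p * φ s x = h s * ∫ x, |u s x| ^ p := by
      rw [← integral_const_mul]
      congr 1; funext x
      by_cases hx : u s x = 0
      · have : p ≠ 0 := by linarith
        simp [hx, this]
      · rw [hφv s ⟨hs.1.le, hs.2⟩, hψ1 x (husupp s hs x hx)]; ring
    rw [this]; ring
  rw [T1, T2, T3, T4, T5, T6, T7] at key
  exact key

lemma power_bound {n : ℕ} (p ρ : ℝ) (hp : 1 < p) (hρ : 0 < ρ) (v : Eucl n → ℝ) (hv : Integrable v)
    (hvp : Integrable (fun x => |v x| ^ p)) (hs : ∀ x, v x ≠ 0 → ‖x‖ ≤ ρ)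
    (hU : 0 < ∫ x, v x) :
    (1 / (2 * (2 * (volume.real (Metric.closedBall (0 : Eucl n) ρ))) ^ (p - 1))) * (∫ x, v x) ^ p
      ≤ ∫ x, |v x| ^ p := by
  set B := Metric.closedBall (0 : Eucl n) ρ with hB
  have hBm : 0 < volume.real B := by
    rw [measureReal_def, ENNReal.toReal_pos_iff]
    exact ⟨Metric.measure_closedBall_pos _ _ hρ, (isCompact_closedBall _ _).measure_lt_top⟩
  set W := volume.real B with hW
  set U := ∫ x, v x with hUd
  set l := U / (2 * W) with hl
  have hl0 : 0 < l := by positivity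
  have hBi : Integrable (B.indicator (fun _ => l ^ p)) :=
    (integrable_indicator_iff Metric.isClosed_closedBall.measurableSet).2
      (integrableOn_const (isCompact_closedBall _ _).measure_lt_top.ne)
  have hlp : l ^ p = l ^ (p - 1) * l := by
    rw [← Real.rpow_add_one hl0.ne']; ring_nf
  have hpt : ∀ x, l ^ (p - 1) * v x ≤ |v x| ^ p + B.indicator (fun _ => l ^ p) x := by
    intro x
    by_cases hx : v x = 0
    · have h1 : 0 ≤ B.indicator (fun _ => l ^ p) x := indicator_nonneg (fun _ _ => by positivity) x
      have h2 : 0 ≤ |v x| ^ p := by positivity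
      rw [hx] at *; simp at *; linarith
    · have hxB : x ∈ B := by simpa [hB] using hs x hx
      rw [indicator_of_mem hxB]
      have hvx : 0 < |v x| := abs_pos.2 hx
      have hvp' : |v x| ^ p = |v x| ^ (p - 1) * |v x| := by
        rw [← Real.rpow_add_one hvx.ne']; ring_nf
      have h2 : 0 ≤ |v x| ^ p := by positivity
      have h3 : 0 < l ^ (p - 1) := by positivity
      have h4 := le_abs_self (v x)
      rcases le_total (|v x|) l with h | h
      · have : l ^ (p - 1) * v x ≤ l ^ p := by rw [hlp]; gcongr; linarith
        linarith
      · have : l ^ (p - 1) * v x ≤ |v x| ^ p := by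
          calc l ^ (p - 1) * v x ≤ l ^ (p - 1) * |v x| := by gcongr
            _ ≤ |v x| ^ (p - 1) * |v x| := by
              gcongr
            _ = _ := hvp'.symm
        have : 0 < l ^ p := by positivity
        linarith
  have hi := integral_mono (hv.const_mul (l ^ (p - 1))) (hvp.add hBi) hpt
  rw [integral_const_mul] at hi
  simp only [Pi.add_apply] at hi
  rw [integral_add hvp hBi, integral_indicator Metric.isClosed_closedBall.measurableSet,
    setIntegral_const, smul_eq_mul, hlp, ← hW, ← hUd] at hi
  have e1 : W * (l ^ (p - 1) * l) = l ^ (p - 1) * U / 2 := by rw [hl]; field_simp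
  have e2 : (1 / (2 * (2 * W) ^ (p - 1))) * U ^ p = l ^ (p - 1) * U / 2 := by
    have : U ^ p = U ^ (p - 1) * U := by rw [← Real.rpow_add_one hU.ne']; ring_nf
    rw [this, hl, Real.div_rpow hU.le (by positivity)]
    field_simp
  rw [e2]; linarith

lemma iter_lemma (q D M τ : ℝ) (F : ℝ → ℝ) (hq : 1 < q) (hM : 0 < M) (hτ : 0 < τ) (hD : 0 ≤ D)
    (h0 : M ≤ F τ)
    (hF : ∀ a b, τ ≤ a → a ≤ b → b ≤ 2 * τ → M ≤ F a → F a + D * (F a) ^ q * (b - a) ^ 2 ≤ F b) :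
    D * M ^ (q - 1) * τ ^ 2 * (1 - (2:ℝ) ^ (-((q - 1) / 2))) ^ 2 < 1 := by
  by_contra hcon
  push Not at hcon
  set θ : ℝ := (2:ℝ) ^ (-((q - 1) / 2)) with hθ
  have hθ0 : 0 < θ := by positivity
  have hθ1 : θ < 1 := Real.rpow_lt_one_of_one_lt_of_neg (by norm_num) (by linarith)
  have hθ2 : θ ^ 2 * (2:ℝ) ^ (q - 1) = 1 := by
    rw [← Real.rpow_natCast θ 2, hθ, ← Real.rpow_mul (by norm_num), ← Real.rpow_add (by norm_num)]
    norm_num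
  have key : ∀ j : ℕ, 2 ^ j * M ≤ F (τ + τ * (1 - θ ^ j)) := by
    intro j
    induction j with
    | zero => simpa using h0
    | succ j ih =>
      have hj1 : θ ^ j ≤ 1 := pow_le_one₀ hθ0.le hθ1.le
      have hj0 : 0 < θ ^ j := by positivity
      have h2j : (1:ℝ) ≤ 2 ^ j := one_le_pow₀ (by norm_num)
      have hMa : M ≤ 2 ^ j * M := by nlinarith
      have := hF (τ + τ * (1 - θ ^ j)) (τ + τ * (1 - θ ^ (j+1)))
        (by nlinarith) (by rw [pow_succ]; nlinarith [mul_pos hτ hj0])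
        (by nlinarith [mul_pos hτ (pow_pos hθ0 (j+1))]) (hMa.trans ih)
      set Y := F (τ + τ * (1 - θ ^ j)) with hY
      have hYq : (2 ^ j * M) ^ q ≤ Y ^ q := Real.rpow_le_rpow (by positivity) ih (by linarith)
      have e1 : (2 ^ j * M) ^ q = (2 ^ j * M) * (((2:ℝ) ^ (q - 1)) ^ j * M ^ (q - 1)) := by
        have : q = 1 + (q - 1) := by ring
        conv_lhs => rw [this]
        rw [Real.rpow_add (by positivity), Real.rpow_one, Real.mul_rpow (by positivity) hM.le]
        congr 2
        rw [← Real.rpow_natCast, ← Real.rpow_natCast, ← Real.rpow_mul (by norm_num),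
          ← Real.rpow_mul (by norm_num), mul_comm]
      have e2 : D * (2 ^ j * M) ^ q * (τ + τ * (1 - θ ^ (j+1)) - (τ + τ * (1 - θ ^ j))) ^ 2
          = (2 ^ j * M) * (D * M ^ (q - 1) * τ ^ 2 * (1 - θ) ^ 2) := by
        have e3 : (θ ^ 2 * (2:ℝ) ^ (q - 1)) ^ j = 1 := by rw [hθ2, one_pow]
        rw [e1]
        calc _ = (2 ^ j * M) * (D * M ^ (q - 1) * τ ^ 2 * (1 - θ) ^ 2) * (θ ^ 2 * (2:ℝ) ^ (q - 1)) ^ j := by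
              rw [mul_pow]; ring
          _ = _ := by rw [e3, mul_one]
      have e4 : D * (2 ^ j * M) ^ q * (τ + τ * (1 - θ ^ (j+1)) - (τ + τ * (1 - θ ^ j))) ^ 2 ≤
         D * Y ^ q * (τ + τ * (1 - θ ^ (j+1)) - (τ + τ * (1 - θ ^ j))) ^ 2 := by gcongr
      have e5 : 2 ^ j * M ≤ (2 ^ j * M) * (D * M ^ (q - 1) * τ ^ 2 * (1 - θ) ^ 2) :=
        le_mul_of_one_le_right (by positivity) hcon
      have e6 : (2:ℝ) ^ (j+1) * M = 2 ^ j * M + 2 ^ j * M := by ring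
      linarith
  obtain ⟨j, hj⟩ := pow_unbounded_of_one_lt (F (2 * τ) / M) (by norm_num : (1:ℝ) < 2)
  rw [div_lt_iff₀ hM] at hj
  have hj1 : θ ^ j ≤ 1 := pow_le_one₀ hθ0.le hθ1.le
  have hj0 : 0 < θ ^ j := by positivity
  have h2j : (1:ℝ) ≤ 2 ^ j := one_le_pow₀ (by norm_num)
  have hMa : M ≤ 2 ^ j * M := by nlinarith
  have := hF (τ + τ * (1 - θ ^ j)) (2 * τ) (by nlinarith) (by nlinarith) le_rfl (hMa.trans (key j))
  have hk := key j
  have : 0 ≤ D * (F (τ + τ * (1 - θ ^ j))) ^ q * (2 * τ - (τ + τ * (1 - θ ^ j))) ^ 2 := by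
    have : 0 ≤ F (τ + τ * (1 - θ ^ j)) := by linarith
    positivity
  linarith

lemma exp_int (δ a t : ℝ) (hδ : 0 ≤ δ) (hat : a ≤ t) :
    (t - a) / (1 + δ * (t - a)) ≤ exp (-(δ * t)) * ∫ s in a..t, exp (δ * s) := by
  rcases hδ.eq_or_lt with h | h
  · subst h; simp
  · have : ∫ s in a..t, exp (δ * s) = (exp (δ * t) - exp (δ * a)) / δ := by
      rw [intervalIntegral.integral_comp_mul_left _ h.ne', integral_exp]
      simp; field_simp
    rw [this]
    have e1 : exp (-(δ * t)) * ((exp (δ * t) - exp (δ * a)) / δ) = (1 - exp (-(δ * (t - a)))) / δ := by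
      rw [mul_div_assoc', mul_sub, ← exp_add, ← exp_add]; ring_nf; simp; ring
    rw [e1]
    have hx : 0 ≤ δ * (t - a) := mul_nonneg hδ (by linarith)
    have h2 : exp (-(δ * (t - a))) * (1 + δ * (t - a)) ≤ 1 := by
      have := add_one_le_exp (δ * (t - a))
      have h3 : exp (-(δ * (t - a))) * exp (δ * (t - a)) = 1 := by rw [← exp_add]; simp
      nlinarith [exp_pos (-(δ * (t - a)))]
    rw [div_le_div_iff₀ (by positivity) h]
    nlinarith

lemma pow_low (κ τ s : ℝ) (hτ : 1 ≤ τ) (h1 : τ ≤ s) (h2 : s ≤ 2 * τ) :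
    min 1 ((3:ℝ) ^ κ) * τ ^ κ ≤ (1 + s) ^ κ := by
  have hτ0 : 0 < τ := by linarith
  have hp : 0 < τ ^ κ := by positivity
  rcases le_total 0 κ with h | h
  · calc _ ≤ 1 * τ ^ κ := by gcongr; exact min_le_left _ _
      _ ≤ _ := by rw [one_mul]; exact Real.rpow_le_rpow hτ0.le (by linarith) h
  · calc _ ≤ 3 ^ κ * τ ^ κ := by gcongr; exact min_le_right _ _
      _ = (3 * τ) ^ κ := (Real.mul_rpow (by norm_num) hτ0.le).symm
      _ ≤ _ := Real.rpow_le_rpow_of_nonpos (by linarith) (by linarith) h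

lemma ode_lemma (q δ κ c1 A0 A1 T : ℝ) (V g : ℝ → ℝ) (hq : 1 < q) (hδ : 0 ≤ δ) (hc1 : 0 < c1)
    (hA0 : 0 < A0) (hA1 : 0 ≤ A1) (hT : 4 ≤ T)
    (hV0 : V 0 = A0) (hVc : ContinuousOn V (Ico 0 T))
    (hVd : ∀ t ∈ Ioo (0:ℝ) T, HasDerivAt V (exp (-(δ * t)) * (A1 + ∫ s in (0:ℝ)..t, g s)) t)
    (hgi : ∀ t ∈ Ico (0:ℝ) T, IntervalIntegrable g volume 0 t)
    (hg0 : ∀ t ∈ Ioo (0:ℝ) T, 0 ≤ g t)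
    (hg : ∀ t ∈ Ioo (0:ℝ) T, 0 < V t → c1 * exp (δ * t) * (1 + t) ^ κ * (V t) ^ q ≤ g t) :
    A0 ≤ V (T / 4) ∧ (δ = 0 → A1 * (T / 4) ≤ V (T / 4)) ∧
    ∀ M > 0, M ≤ V (T / 4) →
      (c1 * min 1 ((3:ℝ) ^ κ) * (T / 4) ^ κ / (2 * (1 + δ * (T / 4)))) * M ^ (q - 1) * (T / 4) ^ 2
        * (1 - (2:ℝ) ^ (-((q - 1) / 2))) ^ 2 < 1 := by
  have hint0 : ∀ t ∈ Ioo (0:ℝ) T, 0 ≤ ∫ s in (0:ℝ)..t, g s := by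
    intro t ht
    rw [intervalIntegral.integral_of_le ht.1.le]
    exact setIntegral_nonneg measurableSet_Ioc (fun s hs => hg0 s ⟨hs.1, hs.2.trans_lt ht.2⟩)
  have hmono : MonotoneOn V (Ico 0 T) := by
    refine monotoneOn_of_deriv_nonneg (convex_Ico 0 T) hVc ?_ ?_
    · rw [interior_Ico]; exact fun t ht => (hVd t ht).differentiableAt.differentiableWithinAt
    · rw [interior_Ico]; intro t ht
      rw [(hVd t ht).deriv]
      have := hint0 t ht
      positivity
  have hVpos : ∀ t ∈ Ico (0:ℝ) T, A0 ≤ V t := by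
    intro t ht
    rw [← hV0]; exact hmono ⟨le_rfl, by linarith⟩ ht ht.1
  refine ⟨hVpos _ ⟨by linarith, by linarith⟩, ?_, ?_⟩
  · intro hδ0
    have : MonotoneOn (fun t => V t - A1 * t) (Ico 0 T) := by
      have hd : ∀ t ∈ Ioo (0:ℝ) T, HasDerivAt (fun t => V t - A1 * t)
        (exp (-(δ * t)) * (A1 + ∫ s in (0:ℝ)..t, g s) - A1 * 1) t :=
        fun t ht => (hVd t ht).sub ((hasDerivAt_id t).const_mul A1)
      refine monotoneOn_of_deriv_nonneg (convex_Ico 0 T) (hVc.sub (by fun_prop)) ?_ ?_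
      · rw [interior_Ico]; exact fun t ht => (hd t ht).differentiableAt.differentiableWithinAt
      · rw [interior_Ico]; intro t ht
        rw [(hd t ht).deriv, hδ0]
        have := hint0 t ht
        simp [this]
    have h := this (a := 0) (b := T/4) ⟨le_rfl, by linarith⟩ ⟨by linarith, by linarith⟩ (by linarith)
    simp only [hV0] at h
    linarith
  · intro M hM hMV
    set τ := T / 4 with hτ
    have hτ1 : 1 ≤ τ := by rw [hτ]; linarith
    have hTτ : T = 4 * τ := by rw [hτ]; ring
    have hτ0 : 0 < τ := by linarith
    have hmin : 0 < min 1 ((3:ℝ) ^ κ) := by positivity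
    refine iter_lemma q _ M τ V hq hM hτ0 (by positivity) hMV ?_
    intro a b ha hab hb hMa
    set B := c1 * min 1 ((3:ℝ) ^ κ) * τ ^ κ with hB
    have hB0 : 0 < B := by positivity
    have hVa : 0 < V a := by linarith
    have hVq : 0 < (V a) ^ q := by positivity
    set D := B / (2 * (1 + δ * τ)) with hD
    have hd : ∀ t ∈ Ioo a b, HasDerivAt (fun t => V t - D * (V a) ^ q * (t - a) ^ 2)
        (exp (-(δ * t)) * (A1 + ∫ s in (0:ℝ)..t, g s) - D * (V a) ^ q * (2 * (t - a))) t := by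
      intro t ht
      refine (hVd t ⟨by linarith [ht.1], by linarith [ht.2]⟩).sub ?_
      have := (((hasDerivAt_id t).sub_const a).pow 2).const_mul (D * (V a) ^ q)
      refine HasDerivAt.congr_deriv (f' := D * V a ^ q * (((2:ℕ):ℝ) * (t - a) ^ (2 - 1) * 1)) this ?_
      norm_num
    have hmon : MonotoneOn (fun t => V t - D * (V a) ^ q * (t - a) ^ 2) (Icc a b) := by
      refine monotoneOn_of_deriv_nonneg (convex_Icc a b)
        ((hVc.mono (fun t ht => ⟨by linarith [ht.1], by linarith [ht.2]⟩)).sub (by fun_prop)) ?_ ?_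
      · rw [interior_Icc]; exact fun t ht => (hd t ht).differentiableAt.differentiableWithinAt
      · rw [interior_Icc]; intro t ht
        rw [(hd t ht).deriv]
        have hat := ht.1
        have htb := ht.2
        have i1 : IntervalIntegrable g volume 0 a := hgi a ⟨by linarith, by linarith⟩
        have i2 : IntervalIntegrable g volume 0 t := hgi t ⟨by linarith, by linarith⟩
        have i3 : IntervalIntegrable g volume a t := i1.symm.trans i2
        have s1 : ∫ s in (0:ℝ)..t, g s = (∫ s in (0:ℝ)..a, g s) + ∫ s in a..t, g s :=
          (intervalIntegral.integral_add_adjacent_intervals i1 i3).symm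
        have s2 := hint0 a ⟨by linarith, by linarith⟩
        have s3 : ∫ s in a..t, (B * (V a) ^ q) * exp (δ * s) ≤ ∫ s in a..t, g s := by
          refine intervalIntegral.integral_mono_on hat.le (Continuous.intervalIntegrable (by fun_prop) _ _) i3 ?_
          intro s hs
          have hsT : s ∈ Ioo (0:ℝ) T := ⟨by linarith [hs.1], by linarith [hs.2]⟩
          have hVs : V a ≤ V s := hmono ⟨by linarith, by linarith⟩ ⟨hsT.1.le, hsT.2⟩ hs.1
          refine le_trans ?_ (hg s hsT (by linarith))
          have p1 := pow_low κ τ s hτ1 (by linarith [hs.1]) (by linarith [hs.2])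
          have p2 : (V a) ^ q ≤ (V s) ^ q := Real.rpow_le_rpow hVa.le hVs (by linarith)
          calc B * (V a) ^ q * exp (δ * s)
              = c1 * exp (δ * s) * (min 1 ((3:ℝ) ^ κ) * τ ^ κ) * (V a) ^ q := by rw [hB]; ring
            _ ≤ _ := by
              have : 0 ≤ (1 + s) ^ κ := Real.rpow_nonneg (by linarith [hsT.1]) _
              gcongr
        rw [intervalIntegral.integral_const_mul] at s3
        have s4 := exp_int δ a t hδ hat.le
        have s5 : (t - a) / (1 + δ * τ) ≤ (t - a) / (1 + δ * (t - a)) := by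
          have : 0 ≤ t - a := by linarith
          have : t - a ≤ τ := by linarith
          gcongr
        have s6 : D * (V a) ^ q * (2 * (t - a)) = (B * (V a) ^ q) * ((t - a) / (1 + δ * τ)) := by
          have : 1 + δ * τ ≠ 0 := by positivity
          rw [hD]; field_simp
        have s7 : exp (-(δ * t)) * ((B * (V a) ^ q) * ∫ s in a..t, exp (δ * s)) ≤
          exp (-(δ * t)) * (A1 + ∫ s in (0:ℝ)..t, g s) := by
          gcongr; linarith
        have s8 : (B * (V a) ^ q) * ((t - a) / (1 + δ * τ)) ≤
          (B * (V a) ^ q) * (exp (-(δ * t)) * ∫ s in a..t, exp (δ * s)) := by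
          gcongr; linarith
        rw [s6]; linarith
    have h := hmon ⟨le_rfl, hab⟩ ⟨hab, le_rfl⟩ hab
    simp only [sub_self] at h
    norm_num at h
    linarith

lemma final_arith (N ε τ γ q : ℝ) (hN : 0 < N) (hε : 0 < ε) (hτ : 0 < τ) (hγ : 0 < γ)
    (h : N * ε ^ (q - 1) * τ ^ γ < 1) : τ ≤ N ^ (-(1 / γ)) * ε ^ (-((q - 1) / γ)) := by
  have hP : 0 < N * ε ^ (q - 1) := by positivity
  have h1 : τ ^ γ ≤ (N * ε ^ (q - 1))⁻¹ := by
    rw [← one_div, le_div_iff₀ hP]; linarith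
  have h2 := Real.rpow_le_rpow (by positivity) h1 (by positivity : 0 ≤ 1 / γ)
  rw [← Real.rpow_mul hτ.le, mul_one_div_cancel hγ.ne', Real.rpow_one,
    Real.inv_rpow hP.le, ← Real.rpow_neg hP.le, Real.mul_rpow hN.le (by positivity),
    ← Real.rpow_mul hε.le] at h2
  convert h2 using 2
  congr 1; ring

lemma init_val (n : ℕ) (c H b m2 β p ε R T ρ : ℝ) (Γ : ℝ → ℝ)
    (hc : 0 < c) (hH : 0 < H) (hp : 1 < p) (hρ : 0 < ρ) (hρR : ρ = R + c / H) (hT : 0 < T)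
    (u0 u1 : Eucl n → ℝ)
    (hu0s : ∀ x, u0 x ≠ 0 → ‖x‖ ≤ R) (hu1s : ∀ x, u1 x ≠ 0 → ‖x‖ ≤ R)
    (u ut : ℝ → Eucl n → ℝ) (hw : IsWeakSolDS n c H b m2 p β Γ ε u0 u1 R T u ut) :
    ∫ x, u 0 x * cutoff n ρ hρ x = ε * ∫ x, u0 x := by
  set ψ := cutoff n ρ hρ with hψ
  obtain ⟨hd, hcont⟩ := hw.c1 ψ ψ.continuous ψ.hasCompactSupport
  set U : ℝ → ℝ := fun s => ∫ x, u s x * ψ x with hU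
  set U1 : ℝ → ℝ := fun s => ∫ x, ut s x * ψ x with hU1
  set G : ℝ → ℝ := fun s => Γ s * (∫ y, |u s y| ^ p) ^ β * ∫ x, |u s x| ^ p with hG
  have hUc : ContinuousOn U (Ico 0 T) := fun t ht => (hd t ht).continuousWithinAt
  have h0m : (0:ℝ) ∈ Ico 0 T := ⟨le_rfl, hT⟩
  have hmemIco : Ico (0:ℝ) T ∈ nhdsWithin (0:ℝ) (Ici 0) := Ico_mem_nhdsGE hT
  have tsub : nhdsWithin (0:ℝ) (Ioi 0) ≤ nhdsWithin (0:ℝ) (Ico 0 T) := by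
    rw [nhdsWithin_Ico_eq_nhdsGE hT]; exact nhdsWithin_mono _ Ioi_subset_Ici_self
  have tU : Filter.Tendsto U (nhdsWithin 0 (Ioi 0)) (nhds (U 0)) := (hUc 0 h0m).mono_left tsub
  have tU1 : Filter.Tendsto U1 (nhdsWithin 0 (Ioi 0)) (nhds (U1 0)) := (hcont 0 h0m).mono_left tsub
  have tid : Filter.Tendsto (fun t : ℝ => t) (nhdsWithin 0 (Ioi 0)) (nhds 0) :=
    Filter.tendsto_id.mono_left nhdsWithin_le_nhds
  have tint : ∀ F : ℝ → ℝ, IntervalIntegrable F volume 0 (T/2) →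
      Filter.Tendsto (fun t => ∫ s in (0:ℝ)..t, F s) (nhdsWithin 0 (Ioi 0)) (nhds 0) := by
    intro F hF
    have h1 := intervalIntegral.continuousOn_primitive_interval (a := 0) (b := T/2) (f := F)
      (μ := volume) (by
        rw [uIcc_of_le (by linarith), integrableOn_Icc_iff_integrableOn_Ioc]
        exact (intervalIntegrable_iff_integrableOn_Ioc_of_le (by linarith)).1 hF)
    have h2 := h1 0 left_mem_uIcc
    unfold ContinuousWithinAt at h2
    simp only [intervalIntegral.integral_same] at h2
    rw [uIcc_of_le (by linarith), nhdsWithin_Icc_eq_nhdsGE (by linarith)] at h2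
    exact h2.mono_left (nhdsWithin_mono _ Ioi_subset_Ici_self)
  have hT2 : T / 2 ∈ Ico 0 T := ⟨by linarith, by linarith⟩
  have hGi : IntervalIntegrable (fun s => s * G s) volume 0 (T/2) :=
    (hw.nonlin_L1loc (T/2) hT2).continuousOn_mul (by fun_prop)
  have hUi : IntervalIntegrable (fun s => (0 - b * 1 + m2 * s) * U s) volume 0 (T/2) := by
    refine ContinuousOn.intervalIntegrable ?_
    refine ContinuousOn.mul (by fun_prop) (hUc.mono ?_)
    rw [uIcc_of_le (by linarith)]
    exact fun s hs => ⟨hs.1, by linarith [hs.2]⟩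
  have hev : ∀ᶠ t in nhdsWithin (0:ℝ) (Ioi 0), 
      U1 t * t - U t * 1 + b * (U t * t) + (∫ s in (0:ℝ)..t, (0 - b * 1 + m2 * s) * U s)
        - ∫ s in (0:ℝ)..t, s * G s = - (ε * ∫ x, u0 x) := by
    filter_upwards [Ioo_mem_nhdsGT hT] with t ht
    have := weak_id n c H b m2 β p ε R T ρ Γ hc hH hp hρ hρR u0 u1 hu0s hu1s u ut hw
      (fun s => s) (fun _ => 1) (fun _ => 0) contDiff_id (fun s => hasDerivAt_id s)
      (fun s => hasDerivAt_const s 1) t ht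
    simp only at this
    rw [← hψ] at this
    linarith
  have hlim := (((((tU1.mul tid).sub (tU.mul_const 1)).add ((tU.mul tid).const_mul b)).add
    (tint _ hUi)).sub (tint _ hGi))
  have hlim2 := hlim.congr' hev
  have := tendsto_nhds_unique hlim2 tendsto_const_nhds
  simp only [mul_zero, mul_one, add_zero, sub_zero, zero_sub] at this
  show U 0 = _
  linarith

lemma sol_bound (n : ℕ) (c H b m2 β p κ μ R ε T ρ δ k1 q I0 I1 c0 : ℝ)
    (hc : 0 < c) (hH : 0 < H) (hb : 0 ≤ b) (hm2 : 0 ≤ m2) (hdom : 4 * m2 ≤ b ^ 2)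
    (hβ : 0 ≤ β) (hp : 1 < p) (hμ : 0 < μ) (hR : 0 < R) (hε : 0 < ε) (hT : 4 ≤ T)
    (hρ : 0 < ρ) (hρR : ρ = R + c / H)
    (u0 u1 : Eucl n → ℝ)
    (hu0s : ∀ x, u0 x ≠ 0 → ‖x‖ ≤ R) (hu1s : ∀ x, u1 x ≠ 0 → ‖x‖ ≤ R)
    (hI0 : I0 = ∫ x, u0 x) (hI1 : I1 = ∫ x, u1 x)
    (hu0nt : 0 < I0) (hu1nt : 0 < I1)
    (hδ : δ = Real.sqrt (b ^ 2 - 4 * m2)) (hk1 : k1 = (1/2) * (b - δ)) (hq : q = (β + 1) * p)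
    (hc0 : c0 = 1 / (2 * (2 * (volume.real (Metric.closedBall (0 : Eucl n) ρ))) ^ (p - 1)))
    (hc0p : 0 < c0)
    (u ut : ℝ → Eucl n → ℝ)
    (hw : IsWeakSolDS n c H b m2 p β
            (fun t => μ * exp ((k1 * (q - 1)) * t) * (1 + t) ^ κ) ε u0 u1 R T u ut) :
    ∃ Vτ, ε * I0 ≤ Vτ ∧ (δ = 0 → ε * (I1 + k1 * I0) * (T / 4) ≤ Vτ) ∧
    ∀ M > 0, M ≤ Vτ →
      (μ * c0 ^ (β + 1) * min 1 ((3:ℝ) ^ κ) * (T / 4) ^ κ / (2 * (1 + δ * (T / 4)))) * M ^ (q - 1)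
        * (T / 4) ^ 2 * (1 - (2:ℝ) ^ (-((q - 1) / 2))) ^ 2 < 1 := by
  have hδ0 : 0 ≤ δ := by rw [hδ]; positivity
  have hδ2 : δ ^ 2 = b ^ 2 - 4 * m2 := by rw [hδ]; exact Real.sq_sqrt (by linarith)
  have hδb : δ ≤ b := by nlinarith
  have hk10 : 0 ≤ k1 := by rw [hk1]; linarith
  have hq1 : 1 < q := by rw [hq]; nlinarith
  set k2 := (1/2) * (b + δ) with hk2
  have hkk : k1 + k2 = b := by rw [hk1, hk2]; ring
  have hkm : k2 ^ 2 - b * k2 + m2 = 0 := by rw [hk2]; nlinarith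
  have hkd : k2 - k1 = δ := by rw [hk1, hk2]; ring
  have hTp : 0 < T := by linarith
  have hinit := init_val n c H b m2 β p ε R T ρ _ hc hH hp hρ hρR hTp u0 u1 hu0s hu1s u ut hw
  have hwid := fun t ht => weak_id n c H b m2 β p ε R T ρ _ hc hH hp hρ hρR u0 u1 hu0s hu1s u ut hw
      (fun s => exp (k2 * s)) (fun s => exp (k2 * s) * k2) (fun s => exp (k2 * s) * k2 * k2)
      (by fun_prop)
      (fun s => by simpa using ((hasDerivAt_id s).const_mul k2).exp)
      (fun s => by simpa using (((hasDerivAt_id s).const_mul k2).exp).mul_const k2) t ht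
  set ψ := cutoff n ρ hρ with hψ
  obtain ⟨hd, hcont⟩ := hw.c1 ψ ψ.continuous ψ.hasCompactSupport
  set U : ℝ → ℝ := fun s => ∫ x, u s x * ψ x with hU
  set U1 : ℝ → ℝ := fun s => ∫ x, ut s x * ψ x with hU1
  set G : ℝ → ℝ := fun s => (μ * exp ((k1 * (q - 1)) * s) * (1 + s) ^ κ) * (∫ y, |u s y| ^ p) ^ β
    * ∫ x, |u s x| ^ p with hG
  have hUc : ContinuousOn U (Ico 0 T) := fun t ht => (hd t ht).continuousWithinAt
  have husupp : ∀ s ∈ Ioo (0:ℝ) T, ∀ x, u s x ≠ 0 → ‖x‖ ≤ ρ := by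
    intro s hs x hx
    refine (hw.supp s hs x hx).trans ?_
    have hcH : 0 < c / H := by positivity
    rw [hρR]
    nlinarith [exp_pos (-(H * s))]
  have hUu : ∀ s ∈ Ioo (0:ℝ) T, U s = ∫ x, u s x := by
    intro s hs
    simp only [hU]
    congr 1; funext x
    by_cases hx : u s x = 0
    · simp [hx]
    · have : ψ x = 1 := (cutoff_eventually ρ hρ x (husupp s hs x hx)).self_of_nhds
      rw [this, mul_one]
  have hflux : ∀ t ∈ Ioo (0:ℝ) T, exp (k2 * t) * (U1 t + k1 * U t) =
      ε * (I1 + k1 * I0) + ∫ s in (0:ℝ)..t, exp (k2 * s) * G s := by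
    intro t ht
    have h := hwid t ht
    have hz : (∫ s in (0:ℝ)..t, (exp (k2 * s) * k2 * k2 - b * (exp (k2 * s) * k2) + m2 * exp (k2 * s))
        * ∫ x, u s x * ψ x) = 0 := by
      have : ∀ s : ℝ, exp (k2 * s) * k2 * k2 - b * (exp (k2 * s) * k2) + m2 * exp (k2 * s) = 0 := by
        intro s
        calc _ = exp (k2 * s) * (k2 ^ 2 - b * k2 + m2) := by ring
          _ = 0 := by rw [hkm, mul_zero]
      simp only [this, zero_mul, intervalIntegral.integral_zero]
    simp only [] at h
    rw [hz] at h
    simp only [mul_zero, exp_zero, one_mul, mul_one, add_zero, ← hI0, ← hI1] at h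
    have e : k1 = b - k2 := by linarith
    rw [e]
    linarith
  have hode := ode_lemma q δ κ (μ * c0 ^ (β + 1)) (ε * I0) (ε * (I1 + k1 * I0)) T
    (fun t => exp (k1 * t) * U t) (fun s => exp (k2 * s) * G s) hq1 hδ0 (by positivity)
    (by positivity) (by positivity) hT (by
      have : U 0 = ε * I0 := by rw [hI0]; exact hinit
      simp [this]) (ContinuousOn.mul (by fun_prop) hUc) ?_ ?_ ?_ ?_
  · exact ⟨_, hode⟩
  · intro t ht
    have h1 : HasDerivAt U (U1 t) t :=
      (hd t ⟨ht.1.le, ht.2⟩).hasDerivAt (Ico_mem_nhds ht.1 ht.2)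
    have h2 : HasDerivAt (fun t => exp (k1 * t)) (exp (k1 * t) * k1) t := by
      simpa using ((hasDerivAt_id t).const_mul k1).exp
    have h3 := h2.mul h1
    refine h3.congr_deriv ?_
    rw [← hflux t ht, ← mul_assoc, ← exp_add]
    have : -(δ * t) + k2 * t = k1 * t := by rw [← hkd]; ring
    rw [this]; ring
  · intro t ht
    exact (hw.nonlin_L1loc t ht).continuousOn_mul (by fun_prop)
  · intro t ht
    have h1 : 0 ≤ ∫ x, |u t x| ^ p := integral_nonneg (fun x => by positivity)
    have h2 : 0 ≤ (1 + t) ^ κ := Real.rpow_nonneg (by linarith [ht.1]) _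
    simp only [hG]
    positivity
  · intro t ht hV
    have hU0 : 0 < U t := pos_of_mul_pos_right hV (exp_pos _).le
    have hpb := power_bound p ρ hp hρ (u t) (hw.integ_u t ⟨ht.1.le, ht.2⟩)
      (hw.integ_pow t ⟨ht.1.le, ht.2⟩) (husupp t ht) (by rw [← hUu t ht]; exact hU0)
    rw [← hc0, ← hUu t ht] at hpb
    set P := ∫ x, |u t x| ^ p with hP
    have hUp : 0 < c0 * U t ^ p := by positivity
    have hP0 : 0 < P := by linarith
    have h2 : 0 ≤ (1 + t) ^ κ := Real.rpow_nonneg (by linarith [ht.1]) _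
    have e1 : c0 ^ (β + 1) * U t ^ q ≤ P ^ β * P := by
      rw [← Real.rpow_add_one hP0.ne', hq, mul_comm (β + 1) p, Real.rpow_mul hU0.le,
        ← Real.mul_rpow hc0p.le (by positivity)]
      exact Real.rpow_le_rpow hUp.le hpb (by linarith)
    simp only [hG]
    rw [← hP]
    have e2 : (exp (k1 * t) * U t) ^ q = exp (k1 * t * q) * U t ^ q := by
      rw [Real.mul_rpow (exp_pos _).le hU0.le, ← Real.exp_mul]
    have e3 : exp (δ * t) * exp (k1 * t * q) = exp (k2 * t) * exp (k1 * (q - 1) * t) := by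
      rw [← exp_add, ← exp_add, ← hkd]; ring_nf
    calc μ * c0 ^ (β + 1) * exp (δ * t) * (1 + t) ^ κ * (exp (k1 * t) * U t) ^ q
        = μ * (exp (δ * t) * exp (k1 * t * q)) * (1 + t) ^ κ * (c0 ^ (β + 1) * U t ^ q) := by
          rw [e2]; ring
      _ = (exp (k2 * t) * (μ * exp (k1 * (q - 1) * t) * (1 + t) ^ κ)) * (c0 ^ (β + 1) * U t ^ q) := by
          rw [e3]; ring
      _ ≤ (exp (k2 * t) * (μ * exp (k1 * (q - 1) * t) * (1 + t) ^ κ)) * (P ^ β * P) := by gcongr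
      _ = _ := by ring

lemma fin_small (T N E : ℝ) (hT : T < 4) (hN : 0 < N) (hE : 1 ≤ E) : T ≤ (4 + 4 * N) * E := by
  nlinarith [mul_pos hN (lt_of_lt_of_le one_pos hE)]

lemma fin_large (T N E : ℝ) (hN : T / 4 ≤ N * E) (hE : 1 ≤ E) : T ≤ (4 + 4 * N) * E := by
  have : (4 + 4 * N) * E = 4 * E + 4 * (N * E) := by ring
  linarith

set_option maxHeartbeats 1000000

/-- **Theorem 2 (case with polynomial growth).**
Blow-up and lifespan estimates for the semilinear wave equation in de Sitter spacetime when
`Γ(t) = μ e^{r_crit t}(1+t)^κ` with `r_crit = ½(b−√(b²−4m²))((β+1)p−1)` and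
`κ > κ_crit(b,m²,β,p)`, where `κ_crit = −1` if `b² > 4m²` and `κ_crit = −1−(β+1)p`
if `b² = 4m²`. The lifespan satisfies `T(ε) ≤ C ε^{−((β+1)p−1)/(κ+1)}` if `b² > 4m²` and
`T(ε) ≤ C ε^{−((κ+2)/((β+1)p−1)+1)⁻¹}` if `b² = 4m²`. -/
theorem deSitter_blowup_polynomial_growth
    (n : ℕ) (hn : 1 ≤ n) (c H b m2 β p κ μ R : ℝ)
    (hc : 0 < c) (hH : 0 < H) (hb : 0 ≤ b) (hm2 : 0 ≤ m2) (hdom : 4 * m2 ≤ b ^ 2)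
    (hβ : 0 ≤ β) (hp : 1 < p)
    (hκ₁ : 4 * m2 < b ^ 2 → -1 < κ)
    (hκ₂ : b ^ 2 = 4 * m2 → -1 - (β + 1) * p < κ)
    (hμ : 0 < μ) (hR : 0 < R)
    (u0 u1 : Eucl n → ℝ)
    (hu0 : ∀ x, 0 ≤ u0 x) (hu1 : ∀ x, 0 ≤ u1 x)
    (hu0i : Integrable u0) (hu1i : Integrable u1)
    (hu0s : ∀ x, u0 x ≠ 0 → ‖x‖ ≤ R) (hu1s : ∀ x, u1 x ≠ 0 → ‖x‖ ≤ R)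
    (hu0nt : 0 < ∫ x, u0 x) (hu1nt : 0 < ∫ x, u1 x) :
    ∃ ε₀ > 0, ∃ C > 0, ∀ ε : ℝ, 0 < ε → ε ≤ ε₀ →
      -- the weak solution blows up in finite time: there is no global-in-time weak solution
      (¬ ∃ u ut : ℝ → Eucl n → ℝ, ∀ T : ℝ, 0 < T →
          IsWeakSolDS n c H b m2 p β
            (fun t => μ * exp (((1/2) * (b - Real.sqrt (b ^ 2 - 4 * m2))
              * ((β + 1) * p - 1)) * t) * (1 + t) ^ κ) ε u0 u1 R T u ut) ∧
      -- upper bound estimates for the lifespan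
      (∀ T : ℝ, 0 < T → ∀ u ut : ℝ → Eucl n → ℝ,
        IsWeakSolDS n c H b m2 p β
          (fun t => μ * exp (((1/2) * (b - Real.sqrt (b ^ 2 - 4 * m2))
            * ((β + 1) * p - 1)) * t) * (1 + t) ^ κ) ε u0 u1 R T u ut →
        (4 * m2 < b ^ 2 →
          T ≤ C * ε ^ (-(((β + 1) * p - 1) / (κ + 1)))) ∧
        (b ^ 2 = 4 * m2 →
          T ≤ C * ε ^ (-((κ + 2) / ((β + 1) * p - 1) + 1)⁻¹))) := by

  set ρ := R + c / H with hρR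
  have hρ : 0 < ρ := by positivity
  set δ := Real.sqrt (b ^ 2 - 4 * m2) with hδ
  set k1 := (1/2) * (b - δ) with hk1
  set q := (β + 1) * p with hq
  set I0 := ∫ x, u0 x with hI0
  set I1 := ∫ x, u1 x with hI1
  set c0 := 1 / (2 * (2 * (volume.real (Metric.closedBall (0 : Eucl n) ρ))) ^ (p - 1)) with hc0
  have hBm : 0 < volume.real (Metric.closedBall (0 : Eucl n) ρ) := by
    rw [measureReal_def, ENNReal.toReal_pos_iff]
    exact ⟨Metric.measure_closedBall_pos _ _ hρ, (isCompact_closedBall _ _).measure_lt_top⟩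
  have hc0p : 0 < c0 := by positivity
  have hδ0 : 0 ≤ δ := by positivity
  have hδ2 : δ ^ 2 = b ^ 2 - 4 * m2 := Real.sq_sqrt (by linarith)
  have hδb : δ ≤ b := by nlinarith
  have hk10 : 0 ≤ k1 := by rw [hk1]; linarith
  have hq1 : 1 < q := by rw [hq]; nlinarith
  have hθ1 : (2:ℝ) ^ (-((q - 1) / 2)) < 1 :=
    Real.rpow_lt_one_of_one_lt_of_neg (by norm_num) (by linarith)
  set η := (1 - (2:ℝ) ^ (-((q - 1) / 2))) ^ 2 with hη
  have hη0 : 0 < η := by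
    have : 0 < 1 - (2:ℝ) ^ (-((q - 1) / 2)) := by linarith
    positivity
  have hmin : 0 < min 1 ((3:ℝ) ^ κ) := by positivity
  have hmain : ∃ C > 0, ∀ ε : ℝ, 0 < ε → ε ≤ 1 → ∀ T : ℝ, 0 < T → ∀ u ut : ℝ → Eucl n → ℝ,
      IsWeakSolDS n c H b m2 p β
          (fun t => μ * exp ((k1 * (q - 1)) * t) * (1 + t) ^ κ) ε u0 u1 R T u ut →
        (4 * m2 < b ^ 2 → T ≤ C * ε ^ (-((q - 1) / (κ + 1)))) ∧
        (b ^ 2 = 4 * m2 → T ≤ C * ε ^ (-((κ + 2) / (q - 1) + 1)⁻¹)) := by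
    rcases hdom.lt_or_eq with hlt | heq
    · have hδp : 0 < δ := Real.sqrt_pos.2 (by linarith)
      have hγ : 0 < κ + 1 := by linarith [hκ₁ hlt]
      set N := μ * c0 ^ (β + 1) * min 1 ((3:ℝ) ^ κ) * η * I0 ^ (q - 1) / (2 * (1 + δ)) with hN
      have hN0 : 0 < N := by positivity
      refine ⟨4 + 4 * N ^ (-(1 / (κ + 1))), by positivity, ?_⟩
      intro ε hε hε1 T hT u ut hw
      refine ⟨fun _ => ?_, fun h => absurd h (by linarith)⟩
      have hεp : 1 ≤ ε ^ (-((q - 1) / (κ + 1))) :=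
        Real.one_le_rpow_of_pos_of_le_one_of_nonpos hε hε1
          (by have : 0 ≤ (q - 1) / (κ + 1) := div_nonneg (by linarith) hγ.le
              linarith)
      have hNp : 0 < N ^ (-(1 / (κ + 1))) := by positivity
      rcases lt_or_ge T 4 with h4 | h4
      · exact fin_small _ _ _ h4 hNp hεp
      obtain ⟨Vτ, hV1, -, hV⟩ := sol_bound n c H b m2 β p κ μ R ε T ρ δ k1 q I0 I1 c0 hc hH hb hm2
        hdom hβ hp hμ hR hε h4 hρ hρR u0 u1 hu0s hu1s hI0 hI1 hu0nt hu1nt hδ hk1 hq hc0 hc0p u ut hw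
      have hb1 := hV (ε * I0) (by positivity) hV1
      set τ := T / 4 with hτ
      have hτ1 : 1 ≤ τ := by rw [hτ]; linarith
      have hτ0 : 0 < τ := by linarith
      have hfin : N * ε ^ (q - 1) * τ ^ (κ + 1) < 1 := by
        refine lt_of_le_of_lt ?_ hb1
        rw [← hη, Real.mul_rpow hε.le hu0nt.le, Real.rpow_add_one hτ0.ne']
        have e1 : 2 * (1 + δ * τ) ≤ 2 * (1 + δ) * τ := by nlinarith
        calc N * ε ^ (q - 1) * (τ ^ κ * τ)
            = (μ * c0 ^ (β + 1) * min 1 ((3:ℝ) ^ κ) * τ ^ κ / (2 * (1 + δ) * τ)) *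
              (ε ^ (q - 1) * I0 ^ (q - 1)) * τ ^ 2 * η := by
              rw [hN]; field_simp
          _ ≤ _ := by gcongr
      have := final_arith N ε τ (κ + 1) q hN0 hε hτ0 hγ hfin
      exact fin_large _ _ _ this hεp
    · have hδz : δ = 0 := by rw [hδ, ← heq]; simp
      have hγ : 0 < κ + 1 + q := by linarith [hκ₂ heq.symm]
      have hexp : -((κ + 2) / (q - 1) + 1)⁻¹ = -((q - 1) / (κ + 1 + q)) := by
        have h1 : q - 1 ≠ 0 := by linarith
        have : (κ + 2) / (q - 1) + 1 = (κ + 1 + q) / (q - 1) := by field_simp; ring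
        rw [this, inv_div]
      set A := I1 + k1 * I0 with hA
      have hA0 : 0 < A := by positivity
      set N := μ * c0 ^ (β + 1) * min 1 ((3:ℝ) ^ κ) * η * A ^ (q - 1) / 2 with hN
      have hN0 : 0 < N := by positivity
      refine ⟨4 + 4 * N ^ (-(1 / (κ + 1 + q))), by positivity, ?_⟩
      intro ε hε hε1 T hT u ut hw
      refine ⟨fun h => absurd h (by linarith), fun _ => ?_⟩
      rw [hexp]
      have hεp : 1 ≤ ε ^ (-((q - 1) / (κ + 1 + q))) :=
        Real.one_le_rpow_of_pos_of_le_one_of_nonpos hε hε1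
          (by have : 0 ≤ (q - 1) / (κ + 1 + q) := div_nonneg (by linarith) hγ.le
              linarith)
      have hNp : 0 < N ^ (-(1 / (κ + 1 + q))) := by positivity
      rcases lt_or_ge T 4 with h4 | h4
      · exact fin_small _ _ _ h4 hNp hεp
      obtain ⟨Vτ, -, hV1, hV⟩ := sol_bound n c H b m2 β p κ μ R ε T ρ δ k1 q I0 I1 c0 hc hH hb hm2
        hdom hβ hp hμ hR hε h4 hρ hρR u0 u1 hu0s hu1s hI0 hI1 hu0nt hu1nt hδ hk1 hq hc0 hc0p u ut hw
      have hb1 := hV (ε * A * (T / 4)) (by positivity) (hV1 hδz)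
      set τ := T / 4 with hτ
      have hτ1 : 1 ≤ τ := by rw [hτ]; linarith
      have hτ0 : 0 < τ := by linarith
      have hfin : N * ε ^ (q - 1) * τ ^ (κ + 1 + q) < 1 := by
        refine lt_of_le_of_lt (le_of_eq ?_) hb1
        have e1 : τ ^ (κ + 1 + q) = τ ^ κ * τ ^ (q - 1) * τ ^ 2 := by
          rw [← Real.rpow_natCast τ 2, ← Real.rpow_add hτ0, ← Real.rpow_add hτ0]
          congr 1; push_cast; ring
        rw [← hη, Real.mul_rpow (by positivity) hτ0.le, Real.mul_rpow hε.le hA0.le, e1, hδz, hN]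
        ring
      have := final_arith N ε τ (κ + 1 + q) q hN0 hε hτ0 hγ hfin
      exact fin_large _ _ _ this hεp
  obtain ⟨C, hC, hmain⟩ := hmain
  refine ⟨1, one_pos, C, hC, fun ε hε hε1 => ⟨?_, hmain ε hε hε1⟩⟩
  rintro ⟨u, ut, hglob⟩
  rcases hdom.lt_or_eq with hlt | heq
  · have hpos : 0 < C * ε ^ (-((q - 1) / (κ + 1))) := by positivity
    have := (hmain ε hε hε1 (C * ε ^ (-((q - 1) / (κ + 1))) + 1) (by linarith) u ut
      (hglob _ (by linarith))).1 hlt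
    linarith
  · have hpos : 0 < C * ε ^ (-((κ + 2) / (q - 1) + 1)⁻¹) := by positivity
    have := (hmain ε hε hε1 (C * ε ^ (-((κ + 2) / (q - 1) + 1)⁻¹) + 1) (by linarith) u ut
      (hglob _ (by linarith))).2 heq.symm
    linarith
end
end

section
/- Let n ≥ 1, c, H > 0 and b, m² ≥ 0 with b² ≥ 4m². Let β ≥ 0, p > 1, r = r_crit(b,m²,β,p) := (1/2)(b − √(b²−4m²))((β+1)p − 1), and κ = κ_crit(b,m²,β,p), where κ_crit := −1 if b² > 4m² and κ_crit := −1 − (β+1)p if b² = 4m². Take Γ(t) = μ e^{r_crit t}(1+t)^{κ_crit} with μ > 0. Assume u₀, u₁ ∈ L¹_loc(ℝⁿ) are nonnegative, nontrivial, and supported in B_R for some R > 0, and let u be a weak solution of the de Sitter problem with lifespan T(ε). Then there exists ε₀ > 0 such that for every ε ∈ (0, ε₀] the solution u blows up in finite time, and T(ε) ≤ C exp(K ε^{−((β+1)p−1)}), where C, K > 0 are independent of ε. -/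
open MeasureTheory Real Set

noncomputable section

lemma ds_step (C d D B N e z y0 : ℝ) (hC : 0 < C) (hd : 0 < d) (hD0 : 0 < D) (hD1 : 1 ≤ D)
    (hDC : 4 ≤ D * C) (hDCd : 4 ≤ D * (C * d)) (hy0p : 0 < y0) (hB : B = 1 + y0)
    (hρj0 : 0 < z) (hρj1 : z ≤ 1) (hN : 0 < N) (hηj : e = D * B * z) (he : 0 < e)
    (hinv : N * (y0 * z ^ 2) = 1) : 2 ≤ C * N * (1 - exp (-(d * e))) * e := by
  have hexpb : d * e / (1 + d * e) ≤ 1 - exp (-(d * e)) := by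
    have hx : 0 < d * e := by positivity
    have h2 : exp (-(d * e)) ≤ 1 / (1 + d * e) := by
      rw [Real.exp_neg, ← one_div]
      exact one_div_le_one_div_of_le (by linarith) (by linarith [Real.add_one_le_exp (d * e)])
    have : d * e / (1 + d * e) = 1 - 1 / (1 + d * e) := by field_simp; ring
    linarith
  have f1 : D ≤ N * e := by
    have h3 : y0 * z ≤ B := by nlinarith
    have h4 : y0 * z ^ 2 ≤ B * z := by
      calc y0 * z ^ 2 = y0 * z * z := by ring
        _ ≤ B * z := by gcongr
    calc D = D * (N * (y0 * z ^ 2)) := by rw [hinv, mul_one]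
      _ ≤ D * (N * (B * z)) := by gcongr
      _ = N * e := by rw [hηj]; ring
  have f2 : D ≤ N * e ^ 2 := by
    have h3 : y0 ≤ B ^ 2 := by rw [hB]; nlinarith
    calc D ≤ D * D := by nlinarith
      _ = D * D * (N * (y0 * z ^ 2)) := by rw [hinv, mul_one]
      _ ≤ D * D * (N * (B ^ 2 * z ^ 2)) := by gcongr
      _ = N * e ^ 2 := by rw [hηj]; ring
  have f3 : 2 ≤ C * N * (d * e / (1 + d * e)) * e := by
    have : C * N * (d * e / (1 + d * e)) * e = (C * N * d * e ^ 2) / (1 + d * e) := by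
      field_simp
    rw [this, le_div_iff₀ (by positivity)]
    have g1 : 4 ≤ C * d * (N * e ^ 2) := by
      calc 4 ≤ C * d * D := by linarith
        _ ≤ _ := by gcongr
    have g2 : 4 * (d * e) ≤ C * (N * e) * (d * e) := by
      apply mul_le_mul_of_nonneg_right _ (by positivity)
      calc 4 ≤ C * D := by linarith
        _ ≤ _ := by gcongr
    linarith
  have f4 : C * N * (d * e / (1 + d * e)) * e ≤ C * N * (1 - exp (-(d * e))) * e := by
    gcongr
  exact f3.trans f4

lemma ds_abstract (q A C d : ℝ) (hq : 1 < q) (hA : 0 < A) (hC : 0 < C) (hd : 0 < d) :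
    ∃ K > 0, ∀ ε : ℝ, 0 < ε → ε ≤ 1 → ∀ (T : ℝ) (X : ℝ → ℝ),
      (∀ t ∈ Ioo (0:ℝ) T, ε * A ≤ X t) →
      (∀ S t M η : ℝ, 0 ≤ S → 0 < M → 0 < η → t ∈ Ioo (0:ℝ) T → (1 + S) * exp (2 * η) ≤ 1 + t →
        (∀ s ∈ Ioo S t, M ≤ X s) → C * M ^ q * (1 - exp (-(d * η))) * η ≤ X t) →
      T ≤ exp (K * ε ^ (-(q - 1))) := by
  obtain ⟨D, hD⟩ : ∃ D, D = 4 / C + 4 / (C * d) + 1 := ⟨_, rfl⟩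
  obtain ⟨ρ, hρ⟩ : ∃ ρ : ℝ, ρ = 2 ^ (-((q - 1) / 2)) := ⟨_, rfl⟩
  have hρ0 : 0 < ρ := by rw [hρ]; positivity
  have hρ1 : ρ < 1 := by
    rw [hρ]; exact Real.rpow_lt_one_of_one_lt_of_neg (by norm_num) (by linarith)
  have hρ2 : (2:ℝ) ^ (-(q - 1)) = ρ ^ 2 := by
    rw [hρ, ← Real.rpow_natCast, ← Real.rpow_mul (by norm_num)]; congr 1; push_cast; ring
  have hD0 : 0 < D := by rw [hD]; positivity
  have hD1 : 1 ≤ D := by rw [hD]; linarith [show 0 < 4 / C by positivity, show 0 < 4 / (C * d) by positivity]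
  have hDC : 4 ≤ D * C := by
    have : 4 / C ≤ D := by rw [hD]; linarith [show 0 < 4 / (C * d) by positivity]
    rwa [div_le_iff₀ hC] at this
  have hDCd : 4 ≤ D * (C * d) := by
    have : 4 / (C * d) ≤ D := by rw [hD]; linarith [show 0 < 4 / C by positivity]
    rwa [div_le_iff₀ (by positivity)] at this
  have hAq : 0 < A ^ (-(q-1)) := by positivity
  have h1ρ : 0 < 1 - ρ := by linarith
  refine ⟨2 * D * (1 + A ^ (-(q - 1))) / (1 - ρ), by positivity, ?_⟩
  intro ε hε hε1 T X h0 h1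
  by_contra hT
  push Not at hT
  set y0 := (ε * A) ^ (-(q - 1)) with hy0
  have hy0p : 0 < y0 := by positivity
  have hεq : 1 ≤ ε ^ (-(q - 1)) := Real.one_le_rpow_of_pos_of_le_one_of_nonpos hε hε1 (by linarith)
  obtain ⟨B, hB⟩ : ∃ B, B = 1 + y0 := ⟨_, rfl⟩
  have hB1 : 1 ≤ B := by linarith
  have hBle : B ≤ (1 + A ^ (-(q - 1))) * ε ^ (-(q - 1)) := by
    rw [hB, hy0, Real.mul_rpow hε.le hA.le]; nlinarith
  let η : ℕ → ℝ := fun j => D * B * ρ ^ j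
  have hη0 : ∀ j, 0 < η j := fun j => by simp only [η]; positivity
  let τ : ℕ → ℝ := fun j => 2 * ∑ i ∈ Finset.range j, η i
  have hτ0 : ∀ j, 0 ≤ τ j := fun j => mul_nonneg (by norm_num) (Finset.sum_nonneg fun i _ => (hη0 i).le)
  have hP : ∀ j : ℕ, ∀ t ∈ Ioo (0:ℝ) T, exp (τ j) ≤ 1 + t → 2 ^ j * (ε * A) ≤ X t := by
    intro j
    induction j with
    | zero => intro t ht _; simpa using h0 t ht
    | succ j ih =>
      intro t ht hexp
      have hM : 0 < 2 ^ j * (ε * A) := by positivity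
      have key := h1 (exp (τ j) - 1) t (2 ^ j * (ε * A)) (η j)
        (by linarith [Real.one_le_exp (hτ0 j)]) hM (hη0 j) ht
        (by
          have : (1 + (exp (τ j) - 1)) * exp (2 * η j) = exp (τ (j+1)) := by
            rw [show 1 + (exp (τ j) - 1) = exp (τ j) by ring, ← Real.exp_add]
            simp only [τ, Finset.sum_range_succ]; congr 1; ring
          linarith)
        (by
          intro s hs
          exact ih s ⟨by linarith [hs.1, Real.one_le_exp (hτ0 j)], hs.2.trans ht.2⟩ (by linarith [hs.1]))
      refine le_trans ?_ key
      set M := 2 ^ j * (ε * A) with hMdef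
      have hMq : M ^ q = M * M ^ (q - 1) := by
        conv_lhs => rw [show q = 1 + (q - 1) by ring, Real.rpow_add hM, Real.rpow_one]
      have hy : M ^ (-(q - 1)) = y0 * (ρ ^ j) ^ 2 := by
        rw [hMdef, Real.mul_rpow (by positivity) (by positivity), ← hy0, mul_comm]
        congr 1
        rw [← pow_mul, mul_comm j 2, pow_mul, ← hρ2, ← Real.rpow_natCast, ← Real.rpow_natCast,
          ← Real.rpow_mul (by norm_num), ← Real.rpow_mul (by norm_num), mul_comm]
      have hinv : M ^ (q - 1) * (y0 * (ρ ^ j) ^ 2) = 1 := by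
        rw [← hy, ← Real.rpow_add hM]; simp
      have hρj0 : 0 < ρ ^ j := by positivity
      have hρj1 : ρ ^ j ≤ 1 := pow_le_one₀ hρ0.le hρ1.le
      have hηj : η j = D * B * ρ ^ j := rfl
      have hst := ds_step C d D B (M ^ (q - 1)) (η j) (ρ ^ j) y0 hC hd hD0 hD1 hDC hDCd hy0p hB
        hρj0 hρj1 (by positivity) hηj (hη0 j) hinv
      calc 2 ^ (j + 1) * (ε * A) = M * 2 := by rw [hMdef]; ring
        _ ≤ M * (C * M ^ (q - 1) * (1 - exp (-(d * η j))) * η j) := by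
          apply mul_le_mul_of_nonneg_left hst hM.le
        _ = _ := by rw [hMq]; ring
  set E := exp (2 * D * (1 + A ^ (-(q - 1))) / (1 - ρ) * ε ^ (-(q - 1))) with hE
  have hτle : ∀ j, exp (τ j) ≤ E := by
    intro j
    apply Real.exp_le_exp.mpr
    have hs : ∑ i ∈ Finset.range j, ρ ^ i ≤ 1 / (1 - ρ) := by
      rw [le_div_iff₀ h1ρ]
      have := mul_neg_geom_sum ρ j
      nlinarith [pow_pos hρ0 j]
    have h6 : τ j = 2 * D * B * ∑ i ∈ Finset.range j, ρ ^ i := by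
      simp only [τ, η]; rw [← Finset.mul_sum]; ring
    calc τ j ≤ 2 * D * B * (1 / (1 - ρ)) := by rw [h6]; gcongr
      _ ≤ 2 * D * ((1 + A ^ (-(q - 1))) * ε ^ (-(q - 1))) * (1 / (1 - ρ)) := by gcongr
      _ = _ := by ring
  have hE0 : 0 < E := by positivity
  have hX : ∀ j : ℕ, 2 ^ j * (ε * A) ≤ X ((E + T) / 2) := fun j =>
    hP j _ ⟨by linarith, by linarith⟩ (by linarith [hτle j])
  obtain ⟨j, hj⟩ := pow_unbounded_of_one_lt (X ((E + T) / 2) / (ε * A)) (by norm_num : (1:ℝ) < 2)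
  rw [div_lt_iff₀ (by positivity)] at hj
  linarith [hX j]

lemma ds_holder {n : ℕ} (p ρ : ℝ) (hp : 1 < p) (hρ : 0 < ρ) :
    ∃ c0 > 0, ∀ v : Eucl n → ℝ, Integrable v → Integrable (fun x => |v x| ^ p) →
      (∀ x, v x ≠ 0 → ‖x‖ ≤ ρ) → c0 * |∫ x, v x| ^ p ≤ ∫ x, |v x| ^ p := by
  set B := Metric.closedBall (0 : Eucl n) ρ with hB
  have hfin : volume B ≠ ⊤ := (isCompact_closedBall _ _).measure_lt_top.ne
  have hpos : volume B ≠ 0 := (Metric.measure_closedBall_pos volume _ hρ).ne'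
  have hV : 0 < volume.real B := ENNReal.toReal_pos hpos hfin
  set V := volume.real B
  refine ⟨V * (V⁻¹) ^ p, by positivity, ?_⟩
  intro v hv hvp hs
  have hout : ∀ x, x ∉ B → v x = 0 := by
    intro x hx; by_contra h; exact hx (by simpa [hB] using hs x h)
  have e1 : ∫ x in B, |v x| = ∫ x, |v x| :=
    setIntegral_eq_integral_of_forall_compl_eq_zero (fun x hx => by simp [hout x hx])
  have e2 : ∫ x in B, |v x| ^ p = ∫ x, |v x| ^ p :=
    setIntegral_eq_integral_of_forall_compl_eq_zero
      (fun x hx => by simp [hout x hx, Real.zero_rpow (by linarith : p ≠ 0)])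
  have hj := ConvexOn.map_set_average_le (μ := volume) (t := B) (f := fun x => |v x|)
    (convexOn_rpow hp.le) (Real.continuous_rpow_const (by linarith)).continuousOn isClosed_Ici
    hpos hfin (Filter.Eventually.of_forall fun x => mem_Ici.mpr (abs_nonneg _)) hv.abs.integrableOn
    hvp.integrableOn
  simp only [setAverage_eq, smul_eq_mul] at hj
  rw [e1] at hj
  have hj2 : (V⁻¹ * ∫ x, |v x|) ^ p ≤ V⁻¹ * ∫ x, |v x| ^ p := by
    rw [← e2]; exact hj
  have h3 : |∫ x, v x| ≤ ∫ x, |v x| := abs_integral_le_integral_abs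
  have h4 : (V⁻¹ * |∫ x, v x|) ^ p ≤ (V⁻¹ * ∫ x, |v x|) ^ p := by gcongr
  rw [Real.mul_rpow (by positivity) (abs_nonneg _)] at h4
  have h5 := mul_le_mul_of_nonneg_left (h4.trans hj2) hV.le
  rw [← mul_assoc, ← mul_assoc, mul_inv_cancel₀ hV.ne', one_mul] at h5
  exact h5

lemma ds_identity {n : ℕ} {c H b m2 p β : ℝ} {Γ : ℝ → ℝ} {ε : ℝ} {u0 u1 : Eucl n → ℝ}
    {R T : ℝ} {u ut : ℝ → Eucl n → ℝ} (hc : 0 < c) (hH : 0 < H) (hR : 0 < R)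
    (hp : 1 < p)
    (hu0s : ∀ x, u0 x ≠ 0 → ‖x‖ ≤ R) (hu1s : ∀ x, u1 x ≠ 0 → ‖x‖ ≤ R)
    (hs : IsWeakSolDS n c H b m2 p β Γ ε u0 u1 R T u ut)
    (t : ℝ) (ht : t ∈ Ioo (0:ℝ) T) (G : ℝ → ℝ) (hG : ContDiff ℝ (⊤ : ℕ∞) G)
    (hGt : G t = 0) (hGt' : deriv G t = -1)
    (hode : ∀ s, deriv (deriv G) s - b * deriv G s + m2 * G s = 0) :
    ∫ x, u t x = ε * (G 0 * ∫ x, u1 x) + ε * ((b * G 0 - deriv G 0) * ∫ x, u0 x)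
      + ∫ s in (0:ℝ)..t, (Γ s * (∫ y, |u s y| ^ p) ^ β * ∫ x, |u s x| ^ p) * G s := by
  have hcH : 0 < c / H := by positivity
  have ht0 := ht.1
  have htT := ht.2
  let χ : ContDiffBump (0 : Eucl n) := ⟨R + c / H, R + c / H + 1, by positivity, by linarith⟩
  let θ : ContDiffBump (t / 2 : ℝ) :=
    ⟨t / 2 + (T - t) / 3, t / 2 + 2 * (T - t) / 3, by linarith, by linarith⟩
  let φ : ℝ → Eucl n → ℝ := fun s x => χ x * (θ s * G s)
  have hθ1 : ∀ s ∈ Icc (0:ℝ) t, ∀ᶠ r in nhds s, θ r = 1 := by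
    intro s hs
    have : s ∈ Metric.ball (t/2) θ.rIn := by
      rw [Metric.mem_ball, Real.dist_eq, abs_lt]
      constructor <;> simp only [θ] <;> linarith [hs.1, hs.2]
    filter_upwards [Metric.isOpen_ball.mem_nhds this] with r hr
    exact θ.one_of_mem_closedBall (Metric.ball_subset_closedBall hr)
  have hφev : ∀ s ∈ Icc (0:ℝ) t, ∀ x, (fun r => φ r x) =ᶠ[nhds s] fun r => χ x * G r := by
    intro s hs x
    filter_upwards [hθ1 s hs] with r hr
    simp [φ, hr]
  have hφ : ∀ s ∈ Icc (0:ℝ) t, ∀ x, φ s x = χ x * G s := fun s hs x => (hφev s hs x).eq_of_nhds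
  have hφ1 : ∀ s ∈ Icc (0:ℝ) t, ∀ x, deriv (fun r => φ r x) s = χ x * deriv G s := by
    intro s hs x
    rw [(hφev s hs x).deriv_eq]
    exact deriv_const_mul_field _
  have hφ2 : ∀ s ∈ Icc (0:ℝ) t, ∀ x, deriv (deriv (fun r => φ r x)) s = χ x * deriv (deriv G) s := by
    intro s hs x
    have : deriv (fun r => φ r x) =ᶠ[nhds s] fun r => χ x * deriv G r := by
      refine (hφev s hs x).deriv.trans (Filter.Eventually.of_forall fun r => ?_)
      exact deriv_const_mul_field _
    rw [this.deriv_eq]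
    exact deriv_const_mul_field _
  have hχ1 : ∀ x : Eucl n, ‖x‖ ≤ R + c / H → χ x = 1 := fun x hx =>
    χ.one_of_mem_closedBall (by simpa [χ] using hx)
  have hlap : ∀ (s : ℝ) (x : Eucl n), ‖x‖ < R + c / H → lapl (fun y => φ s y) x = 0 := by
    intro s x hx
    unfold lapl
    apply Finset.sum_eq_zero
    intro i _
    have hev : ∀ᶠ y in nhds x, ‖y‖ < R + c / H := continuous_norm.continuousAt.eventually_lt_const hx
    have hz : (fun y => fderiv ℝ (fun y => φ s y) y (EuclideanSpace.single i 1)) =ᶠ[nhds x]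
        fun _ => (0:ℝ) := by
      filter_upwards [hev] with y hy
      have hev' : (fun y => φ s y) =ᶠ[nhds y] fun _ => θ s * G s := by
        filter_upwards [continuous_norm.continuousAt.eventually_lt_const hy] with z hz
        simp [φ, hχ1 z hz.le]
      rw [hev'.fderiv_eq]; simp
    rw [hz.fderiv_eq]; simp
  have htest : IsTestFn T φ := by
    refine ⟨?_, ?_, t + 2 * (T - t) / 3, by linarith, ?_⟩
    · have h1 : ContDiff ℝ (⊤ : ℕ∞) (fun x : Eucl n => χ x) := χ.contDiff
      have h2 : ContDiff ℝ (⊤ : ℕ∞) (fun x : ℝ => θ x) := θ.contDiff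
      exact (h1.comp contDiff_snd).mul ((h2.comp contDiff_fst).mul (hG.comp contDiff_fst))
    · refine HasCompactSupport.intro
        ((isCompact_closedBall (t/2) θ.rOut).prod (isCompact_closedBall (0 : Eucl n) χ.rOut)) ?_
      rintro ⟨s, x⟩ hq
      rw [Set.mem_prod, not_and_or] at hq
      rcases hq with hq | hq
      · have : θ s = 0 := θ.zero_of_le_dist (by simpa using (not_le.mp hq).le)
        simp [φ, this]
      · have : χ x = 0 := χ.zero_of_le_dist (not_le.mp (fun h => hq (Metric.mem_closedBall.mpr h))).le
        simp [φ, this]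
    · intro s hs x
      have : θ s = 0 := θ.zero_of_le_dist (by
        rw [Real.dist_eq]; refine le_trans ?_ (le_abs_self _); simp only [θ]; linarith)
      simp [φ, this]
  have hid := hs.identity t ht φ htest
  have htI : t ∈ Icc (0:ℝ) t := ⟨ht0.le, le_rfl⟩
  have h0I : (0:ℝ) ∈ Icc (0:ℝ) t := ⟨le_rfl, ht0.le⟩
  have hsup : ∀ s ∈ Ioc (0:ℝ) t, ∀ x, u s x ≠ 0 → ‖x‖ < R + c / H := by
    intro s hs' x hx
    have := hs.supp s ⟨hs'.1, hs'.2.trans_lt htT⟩ x hx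
    have he := Real.exp_pos (-(H * s))
    nlinarith
  have hχu : ∀ s ∈ Ioc (0:ℝ) t, ∀ x, u s x * χ x = u s x := by
    intro s hs' x
    by_cases h : u s x = 0
    · simp [h]
    · rw [hχ1 x (hsup s hs' x h).le, mul_one]
  have hχup : ∀ s ∈ Ioc (0:ℝ) t, ∀ x, |u s x| ^ p * χ x = |u s x| ^ p := by
    intro s hs' x
    by_cases h : u s x = 0
    · simp [h, Real.zero_rpow (by linarith : p ≠ 0)]
    · rw [hχ1 x (hsup s hs' x h).le, mul_one]
  have hχ0 : ∀ x, u0 x * χ x = u0 x := by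
    intro x
    by_cases h : u0 x = 0
    · simp [h]
    · rw [hχ1 x (by linarith [hu0s x h]), mul_one]
  have hχ1' : ∀ x, u1 x * χ x = u1 x := by
    intro x
    by_cases h : u1 x = 0
    · simp [h]
    · rw [hχ1 x (by linarith [hu1s x h]), mul_one]
  have e1 : ∫ x, ut t x * φ t x = 0 := by simp [hφ t htI, hGt]
  have e2 : ∫ x, u t x * deriv (fun s => φ s x) t = - ∫ x, u t x := by
    rw [← integral_neg]
    congr 1; ext x
    rw [hφ1 t htI, hGt', ← mul_assoc, hχu t ⟨ht0, le_rfl⟩]; ring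
  have e3 : ∫ x, u t x * φ t x = 0 := by simp [hφ t htI, hGt]
  have e4 : (∫ s in (0:ℝ)..t, ∫ x, u s x *
            (deriv (deriv (fun r => φ r x)) s
              - c ^ 2 * exp (-(2 * H * s)) * lapl (fun y => φ s y) x
              - b * deriv (fun r => φ r x) s + m2 * φ s x)) = 0 := by
    rw [intervalIntegral.integral_congr_ae (g := fun _ => (0:ℝ))]
    · simp
    · refine Filter.Eventually.of_forall fun s hs' => ?_
      rw [uIoc_of_le ht0.le] at hs'
      have hsI : s ∈ Icc (0:ℝ) t := ⟨hs'.1.le, hs'.2⟩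
      rw [← integral_zero (Eucl n) ℝ]
      congr 1; ext x
      by_cases h : u s x = 0
      · simp [h]
      · rw [hφ2 s hsI, hφ1 s hsI, hφ s hsI, hlap s x (hsup s hs' x h)]
        linear_combination u s x * χ x * hode s
  have e5 : ∫ x, u1 x * φ 0 x = G 0 * ∫ x, u1 x := by
    rw [← integral_const_mul]
    congr 1; ext x
    rw [hφ 0 h0I, ← mul_assoc, hχ1']; ring
  have e6 : ∫ x, u0 x * (b * φ 0 x - deriv (fun s => φ s x) 0)
      = (b * G 0 - deriv G 0) * ∫ x, u0 x := by
    rw [← integral_const_mul]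
    congr 1; ext x
    rw [hφ 0 h0I, hφ1 0 h0I]
    linear_combination (b * G 0 - deriv G 0) * hχ0 x
  have e7 : (∫ s in (0:ℝ)..t, Γ s * (∫ y, |u s y| ^ p) ^ β * (∫ x, |u s x| ^ p * φ s x))
      = ∫ s in (0:ℝ)..t, (Γ s * (∫ y, |u s y| ^ p) ^ β * ∫ x, |u s x| ^ p) * G s := by
    apply intervalIntegral.integral_congr_ae
    refine Filter.Eventually.of_forall fun s hs' => ?_
    rw [uIoc_of_le ht0.le] at hs'
    have hsI : s ∈ Icc (0:ℝ) t := ⟨hs'.1.le, hs'.2⟩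
    have : ∫ x, |u s x| ^ p * φ s x = (∫ x, |u s x| ^ p) * G s := by
      rw [← integral_mul_const]
      congr 1; ext x
      rw [hφ s hsI, ← mul_assoc, hχup s hs']
    simp only [this]; ring
  rw [e1, e2, e3, e4, e5, e6, e7] at hid
  linarith

lemma ds_int_lower (f : ℝ → ℝ) (S m t a : ℝ) (hS : 0 ≤ S) (hSm : S ≤ m) (hmt : m ≤ t)
    (hf : IntervalIntegrable f volume 0 t) (hf0 : ∀ s ∈ Ioc (0:ℝ) t, 0 ≤ f s)
    (hfa : ∀ s ∈ Ioo S m, a * (1 + s)⁻¹ ≤ f s) :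
    a * Real.log ((1 + m) / (1 + S)) ≤ ∫ s in (0:ℝ)..t, f s := by
  have h1 : ∫ s in S..m, a * (1 + s)⁻¹ = a * Real.log ((1 + m) / (1 + S)) := by
    rw [intervalIntegral.integral_const_mul]
    congr 1
    have := intervalIntegral.integral_comp_add_left (a := S) (b := m) (fun x : ℝ => x⁻¹) 1
    rw [this, integral_inv_of_pos (by linarith) (by linarith)]
  have hsub : IntervalIntegrable f volume S m := by
    apply hf.mono_set
    rw [uIcc_of_le hSm, uIcc_of_le (by linarith)]
    exact Icc_subset_Icc hS hmt
  have hcont : IntervalIntegrable (fun s : ℝ => a * (1 + s)⁻¹) volume S m := by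
    apply ContinuousOn.intervalIntegrable
    rw [uIcc_of_le hSm]
    apply ContinuousOn.mul continuousOn_const
    apply ContinuousOn.inv₀ (by fun_prop)
    intro x hx
    linarith [hx.1]
  have h2 : ∫ s in S..m, a * (1 + s)⁻¹ ≤ ∫ s in S..m, f s :=
    intervalIntegral.integral_mono_on_of_le_Ioo hSm hcont hsub hfa
  have h3 : ∫ s in S..m, f s ≤ ∫ s in (0:ℝ)..t, f s := by
    apply intervalIntegral.integral_mono_interval hS hSm hmt _ hf
    exact (ae_restrict_iff' measurableSet_Ioc).mpr (Filter.Eventually.of_forall hf0)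
  linarith

lemma ds_core (n : ℕ) (c H b m2 β p κ μ R : ℝ)
    (hc : 0 < c) (hH : 0 < H)
    (hβ : 0 ≤ β) (hp : 1 < p) (hμ : 0 < μ) (hR : 0 < R)
    (u0 u1 : Eucl n → ℝ)
    (hu0s : ∀ x, u0 x ≠ 0 → ‖x‖ ≤ R) (hu1s : ∀ x, u1 x ≠ 0 → ‖x‖ ≤ R)
    (k d C' A : ℝ) (hd : 0 < d) (hC' : 0 < C') (hA : 0 < A) (g w : ℝ → ℝ)
    (hg : ContDiff ℝ (⊤ : ℕ∞) g) (hg0 : g 0 = 0) (hg1 : deriv g 0 = 1)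
    (hode : ∀ τ, deriv (deriv g) τ + b * deriv g τ + m2 * g τ = 0)
    (hgnn : ∀ τ, 0 ≤ τ → 0 ≤ g τ) (hw : ∀ t, 0 ≤ t → 0 < w t)
    (hdata : ∀ t, 0 < t → A * (exp (-(k * t)) * w t)
      ≤ g t * (∫ x, u1 x) + (b * g t + deriv g t) * ∫ x, u0 x)
    (hκ : ∀ s, 0 ≤ s → (1 + s) ^ κ * w s ^ ((β + 1) * p) = (1 + s)⁻¹)
    (hker : ∀ s t η, 0 ≤ s → 0 < η → (1 + s) * exp η ≤ 1 + t →
      w t * C' * (1 - exp (-(d * η))) * exp (-(k * (t - s))) ≤ g (t - s)) :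
    ∃ K > 0, ∀ ε : ℝ, 0 < ε → ε ≤ 1 → ∀ T : ℝ, 0 < T → ∀ u ut : ℝ → Eucl n → ℝ,
        IsWeakSolDS n c H b m2 p β
          (fun t => μ * exp ((k * ((β + 1) * p - 1)) * t) * (1 + t) ^ κ) ε u0 u1 R T u ut →
        T ≤ exp (K * ε ^ (-((β + 1) * p - 1))) := by
  have hcH : 0 < c / H := by positivity
  obtain ⟨c0, hc0, hold⟩ := ds_holder (n := n) p (R + c / H) hp (by positivity)
  have hq : 1 < (β + 1) * p := by nlinarith
  obtain ⟨q, hqdef⟩ : ∃ q, q = (β + 1) * p := ⟨_, rfl⟩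
  rw [← hqdef] at hq hκ ⊢
  obtain ⟨c1, hc1def⟩ : ∃ c1, c1 = c0 ^ (β + 1) := ⟨_, rfl⟩
  have hc1 : 0 < c1 := by rw [hc1def]; positivity
  obtain ⟨K, hK, hmain⟩ := ds_abstract q A (μ * c1 * C') d hq hA (by positivity) hd
  refine ⟨K, hK, ?_⟩
  intro ε hε hε1 T hT u ut hs
  set Γ : ℝ → ℝ := fun t => μ * exp ((k * (q - 1)) * t) * (1 + t) ^ κ with hΓ
  have hΓ0 : ∀ s, 0 ≤ s → 0 ≤ Γ s := by
    intro s hs'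
    simp only [hΓ]
    have : 0 < 1 + s := by linarith
    positivity
  have hI0 : ∀ s, 0 ≤ ∫ x, |u s x| ^ p := fun s => integral_nonneg fun x => by positivity
  obtain ⟨F, hF⟩ : ∃ F : ℝ → ℝ, F = fun s => Γ s * (∫ y, |u s y| ^ p) ^ β * ∫ x, |u s x| ^ p :=
    ⟨_, rfl⟩
  have hF0 : ∀ s, 0 ≤ s → 0 ≤ F s := by
    intro s hs'
    rw [hF]
    exact mul_nonneg (mul_nonneg (hΓ0 s hs') (Real.rpow_nonneg (hI0 s) _)) (hI0 s)
  have hFlow : ∀ s ∈ Ioo (0:ℝ) T, Γ s * (c1 * |∫ x, u s x| ^ q) ≤ F s := by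
    intro s hs'
    have h1 := hold (u s) (hs.integ_u s ⟨hs'.1.le, hs'.2⟩) (hs.integ_pow s ⟨hs'.1.le, hs'.2⟩)
      (fun x hx => by
        have := hs.supp s hs' x hx
        have he := Real.exp_pos (-(H * s))
        nlinarith)
    have h2 : (c0 * |∫ x, u s x| ^ p) ^ (β + 1) ≤ (∫ x, |u s x| ^ p) ^ (β + 1) := by
      gcongr
    have h3 : (c0 * |∫ x, u s x| ^ p) ^ (β + 1) = c1 * |∫ x, u s x| ^ q := by
      rw [Real.mul_rpow hc0.le (by positivity), ← Real.rpow_mul (abs_nonneg _), hc1def, hqdef,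
        mul_comm p]
    have h4 : (∫ x, |u s x| ^ p) ^ (β + 1) = (∫ x, |u s x| ^ p) ^ β * ∫ x, |u s x| ^ p := by
      rw [Real.rpow_add_of_nonneg (hI0 s) hβ zero_le_one, Real.rpow_one]
    rw [h3, h4] at h2
    rw [hF]
    calc _ ≤ Γ s * ((∫ x, |u s x| ^ p) ^ β * ∫ x, |u s x| ^ p) :=
          mul_le_mul_of_nonneg_left h2 (hΓ0 s hs'.1.le)
      _ = _ := by ring
  have hU : ∀ t ∈ Ioo (0:ℝ) T, ε * (A * (exp (-(k * t)) * w t))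
      + ∫ s in (0:ℝ)..t, F s * g (t - s) ≤ ∫ x, u t x := by
    intro t ht
    have hd1 : ∀ s, deriv (fun s => g (t - s)) s = - deriv g (t - s) := fun s => deriv_comp_const_sub ..
    have hd2 : ∀ s, deriv (deriv (fun s => g (t - s))) s = deriv (deriv g) (t - s) := by
      intro s
      rw [funext hd1, deriv.fun_neg, deriv_comp_const_sub, neg_neg]
    have := ds_identity hc hH hR hp hu0s hu1s hs t ht (fun s => g (t - s))
      (hg.comp (contDiff_const.sub contDiff_id)) (by simp [hg0]) (by rw [hd1]; simp [hg1])
      (fun s => by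
        rw [hd1, hd2]; linarith [hode (t - s)])
    rw [this, hd1]
    simp only [sub_zero, hF]
    have h5 := mul_le_mul_of_nonneg_left (hdata t ht.1) hε.le
    linarith
  have hFint : ∀ t ∈ Ioo (0:ℝ) T, IntervalIntegrable (fun s => F s * g (t - s)) volume 0 t := by
    intro t ht
    have h1 := hs.nonlin_L1loc t ⟨ht.1.le, ht.2⟩
    rw [hF]
    exact h1.mul_continuousOn (hg.continuous.comp (by fun_prop)).continuousOn
  have hFg0 : ∀ t, ∀ s ∈ Ioc (0:ℝ) t, 0 ≤ F s * g (t - s) := fun t s hs' =>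
    mul_nonneg (hF0 s hs'.1.le) (hgnn _ (by linarith [hs'.2]))
  have hW : ∀ t, 0 ≤ t → 0 < exp (-(k * t)) * w t := fun t ht => mul_pos (Real.exp_pos _) (hw t ht)
  apply hmain ε hε hε1 T (fun t => (∫ x, u t x) / (exp (-(k * t)) * w t))
  · intro t ht
    rw [le_div_iff₀ (hW t ht.1.le)]
    have h1 := hU t ht
    have h2 : 0 ≤ ∫ s in (0:ℝ)..t, F s * g (t - s) := by
      rw [intervalIntegral.integral_of_le ht.1.le]
      exact setIntegral_nonneg measurableSet_Ioc (hFg0 t)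
    linarith
  · intro S t M η hS hM hη ht hSt hX
    rw [le_div_iff₀ (hW t ht.1.le)]
    have hexpη : 1 + η ≤ exp η := by linarith [Real.add_one_le_exp η]
    have hexp2 : exp (2 * η) = exp η * exp η := by rw [← Real.exp_add]; congr 1; ring
    obtain ⟨m, hm⟩ : ∃ m, m = (1 + S) * exp η - 1 := ⟨_, rfl⟩
    have h1m : 1 + m = (1 + S) * exp η := by rw [hm]; ring
    have hSm : S ≤ m := by nlinarith
    have hmt : (1 + m) * exp η ≤ 1 + t := by rw [h1m]; rw [hexp2] at hSt; linarith
    have hmt' : m < t := by nlinarith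
    have hDpos : 0 ≤ 1 - exp (-(d * η)) := by
      have : exp (-(d * η)) ≤ 1 := Real.exp_le_one_iff.mpr (by nlinarith)
      linarith
    have hwt := hw t ht.1.le
    have hlow := ds_int_lower (fun s => F s * g (t - s)) S m t
      (μ * c1 * C' * M ^ q * (1 - exp (-(d * η))) * (exp (-(k * t)) * w t)) hS hSm hmt'.le
      (hFint t ht) (hFg0 t) (by
        intro s hs'
        have hs0 : 0 < s := by linarith [hs'.1]
        have hsT : s ∈ Ioo (0:ℝ) T := ⟨hs0, by linarith [hs'.2, ht.2]⟩
        have hXs := hX s ⟨hs'.1, by linarith [hs'.2]⟩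
        have hws := hw s hs0.le
        rw [le_div_iff₀ (hW s hs0.le)] at hXs
        have hk := hker s t η hs0.le hη (le_trans (by
          apply mul_le_mul_of_nonneg_right _ (Real.exp_pos _).le
          linarith [hs'.2]) hmt)
        have h1 : (M * (exp (-(k * s)) * w s)) ^ q ≤ |∫ x, u s x| ^ q := by
          apply Real.rpow_le_rpow (by positivity) (hXs.trans (le_abs_self _)) (by linarith)
        have h2 : (M * (exp (-(k * s)) * w s)) ^ q = M ^ q * (exp (-(k * s) * q) * w s ^ q) := by
          rw [Real.mul_rpow hM.le (by positivity), Real.mul_rpow (by positivity) hws.le,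
            ← Real.exp_mul]
        have h3 : Γ s * (c1 * (M * (exp (-(k * s)) * w s)) ^ q)
            = μ * c1 * M ^ q * exp (-(k * s)) * (1 + s)⁻¹ := by
          have he : exp (k * (q - 1) * s) * exp (-(k * s) * q) = exp (-(k * s)) := by
            rw [← Real.exp_add]; congr 1; ring
          rw [h2, ← he, ← hκ s hs0.le]
          simp only [hΓ]; ring
        have h4 : μ * c1 * M ^ q * exp (-(k * s)) * (1 + s)⁻¹ ≤ F s := by
          rw [← h3]
          refine le_trans ?_ (hFlow s hsT)
          exact mul_le_mul_of_nonneg_left (mul_le_mul_of_nonneg_left h1 hc1.le) (hΓ0 s hs0.le)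
        have h5 : exp (-(k * t)) = exp (-(k * s)) * exp (-(k * (t - s))) := by
          rw [← Real.exp_add]; congr 1; ring
        calc _ = (μ * c1 * M ^ q * exp (-(k * s)) * (1 + s)⁻¹)
              * (w t * C' * (1 - exp (-(d * η))) * exp (-(k * (t - s)))) := by rw [h5]; ring
          _ ≤ F s * g (t - s) := by
            apply mul_le_mul h4 hk _ (hF0 s hs0.le)
            positivity)
    have hlog : Real.log ((1 + m) / (1 + S)) = η := by
      rw [h1m, mul_comm, mul_div_assoc, div_self (by linarith), mul_one, Real.log_exp]
    rw [hlog] at hlow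
    have h6 := hU t ht
    have h7 : 0 ≤ ε * (A * (exp (-(k * t)) * w t)) := by positivity
    calc _ = μ * c1 * C' * M ^ q * (1 - exp (-(d * η))) * (exp (-(k * t)) * w t) * η := by ring
      _ ≤ _ := by linarith

lemma ds_exp_ker (s t η : ℝ) (hs : 0 ≤ s) (hη : 0 < η) (h : (1 + s) * exp η ≤ 1 + t) :
    η ≤ t - s := by
  nlinarith [Real.add_one_le_exp η]

lemma ds_bound (n : ℕ) (c H b m2 β p κ μ R : ℝ)
    (hc : 0 < c) (hH : 0 < H) (hb : 0 ≤ b) (hm2 : 0 ≤ m2) (hdom : 4 * m2 ≤ b ^ 2)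
    (hβ : 0 ≤ β) (hp : 1 < p)
    (hκ₁ : 4 * m2 < b ^ 2 → κ = -1)
    (hκ₂ : b ^ 2 = 4 * m2 → κ = -1 - (β + 1) * p)
    (hμ : 0 < μ) (hR : 0 < R)
    (u0 u1 : Eucl n → ℝ)
    (hu0s : ∀ x, u0 x ≠ 0 → ‖x‖ ≤ R) (hu1s : ∀ x, u1 x ≠ 0 → ‖x‖ ≤ R)
    (hu0nt : 0 < ∫ x, u0 x) (hu1nt : 0 < ∫ x, u1 x) :
    ∃ K > 0, ∀ ε : ℝ, 0 < ε → ε ≤ 1 → ∀ T : ℝ, 0 < T → ∀ u ut : ℝ → Eucl n → ℝ,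
        IsWeakSolDS n c H b m2 p β
          (fun t => μ * exp (((1/2) * (b - Real.sqrt (b ^ 2 - 4 * m2))
            * ((β + 1) * p - 1)) * t) * (1 + t) ^ κ) ε u0 u1 R T u ut →
        T ≤ exp (K * ε ^ (-((β + 1) * p - 1))) := by
  set I0 := ∫ x, u0 x with hI0
  set I1 := ∫ x, u1 x with hI1
  obtain ⟨δ, hδ⟩ : ∃ δ, δ = Real.sqrt (b ^ 2 - 4 * m2) := ⟨_, rfl⟩
  have hδ2 : δ ^ 2 = b ^ 2 - 4 * m2 := by rw [hδ]; exact Real.sq_sqrt (by linarith)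
  have hδ0 : 0 ≤ δ := by rw [hδ]; exact Real.sqrt_nonneg _
  have hδb : δ ≤ b := by nlinarith
  rw [← hδ]
  obtain ⟨k, hk⟩ : ∃ k, k = 1 / 2 * (b - δ) := ⟨_, rfl⟩
  have hk0 : 0 ≤ k := by rw [hk]; linarith
  have hb' : b = 2 * k + δ := by rw [hk]; ring
  have hm' : m2 = k * (k + δ) := by rw [hk]; nlinarith
  rw [← hk]
  rcases hdom.lt_or_eq with hlt | heq
  · have hδp : 0 < δ := by
      rcases hδ0.lt_or_eq with h | h
      · exact h
      · rw [← h] at hδ2; nlinarith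
    have hκ := hκ₁ hlt
    -- kernel
    have hder : ∀ τ, HasDerivAt (fun τ => (exp (-(k * τ)) - exp (-((k + δ) * τ))) / δ)
        ((-k * exp (-(k * τ)) + (k + δ) * exp (-((k + δ) * τ))) / δ) τ := by
      intro τ
      have h1 : HasDerivAt (fun τ : ℝ => -(k * τ)) (-(k * 1)) τ :=
        ((hasDerivAt_id τ).const_mul k).neg
      have h2 : HasDerivAt (fun τ : ℝ => -((k + δ) * τ)) (-((k + δ) * 1)) τ :=
        ((hasDerivAt_id τ).const_mul (k + δ)).neg
      refine HasDerivAt.congr_deriv ((h1.exp.sub h2.exp).div_const δ) ?_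
      ring
    have hder2 : ∀ τ, HasDerivAt
        (fun τ => (-k * exp (-(k * τ)) + (k + δ) * exp (-((k + δ) * τ))) / δ)
        ((k ^ 2 * exp (-(k * τ)) - (k + δ) ^ 2 * exp (-((k + δ) * τ))) / δ) τ := by
      intro τ
      have h1 : HasDerivAt (fun τ : ℝ => -(k * τ)) (-(k * 1)) τ :=
        ((hasDerivAt_id τ).const_mul k).neg
      have h2 : HasDerivAt (fun τ : ℝ => -((k + δ) * τ)) (-((k + δ) * 1)) τ :=
        ((hasDerivAt_id τ).const_mul (k + δ)).neg
      refine HasDerivAt.congr_deriv (((h1.exp.const_mul (-k)).add (h2.exp.const_mul (k + δ))).div_const δ) ?_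
      ring
    have hd1 := fun τ => (hder τ).deriv
    have hfac : ∀ τ, exp (-((k + δ) * τ)) = exp (-(k * τ)) * exp (-(δ * τ)) := by
      intro τ; rw [← Real.exp_add]; congr 1; ring
    have hnn : ∀ τ, 0 ≤ τ → 0 ≤ (exp (-(k * τ)) - exp (-((k + δ) * τ))) / δ := by
      intro τ hτ
      apply div_nonneg _ hδ0
      have : exp (-((k + δ) * τ)) ≤ exp (-(k * τ)) := Real.exp_le_exp.mpr (by nlinarith)
      linarith
    refine ds_core n c H b m2 β p κ μ R hc hH hβ hp hμ hR u0 u1 hu0s hu1s k δ (1 / δ) I0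
      hδp (by positivity) hu0nt (fun τ => (exp (-(k * τ)) - exp (-((k + δ) * τ))) / δ) (fun _ => 1)
      ?_ ?_ ?_ ?_ hnn ?_ ?_ ?_ ?_
    · fun_prop
    · simp
    · rw [hd1]; simp [hδp.ne']
    · intro τ
      rw [funext hd1, (hder2 τ).deriv, hb', hm']
      field_simp; ring
    · intro t ht; norm_num
    · intro t ht
      rw [hd1, ← hI0, ← hI1]
      have h1 := mul_nonneg (hnn t ht.le) hu1nt.le
      have h2 : exp (-(k * t)) ≤ b * ((exp (-(k * t)) - exp (-((k + δ) * t))) / δ) +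
          (-k * exp (-(k * t)) + (k + δ) * exp (-((k + δ) * t))) / δ := by
        have h3 : b * ((exp (-(k * t)) - exp (-((k + δ) * t))) / δ) +
          (-k * exp (-(k * t)) + (k + δ) * exp (-((k + δ) * t))) / δ
          = exp (-(k * t)) + k * ((exp (-(k * t)) - exp (-((k + δ) * t))) / δ) := by
          rw [hb']; field_simp; ring
        rw [h3]
        linarith [mul_nonneg hk0 (hnn t ht.le)]
      have := mul_le_mul_of_nonneg_right h2 hu0nt.le
      linarith
    · intro s hs
      rw [hκ, Real.one_rpow, mul_one, Real.rpow_neg_one]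
    · intro s t η hs hη h
      have h1 := ds_exp_ker s t η hs hη h
      have h2 : exp (-(δ * (t - s))) ≤ exp (-(δ * η)) := Real.exp_le_exp.mpr (by nlinarith)
      rw [hfac]
      calc 1 * (1 / δ) * (1 - exp (-(δ * η))) * exp (-(k * (t - s)))
          ≤ 1 * (1 / δ) * (1 - exp (-(δ * (t - s)))) * exp (-(k * (t - s))) := by gcongr
        _ = _ := by ring
  · have hκ := hκ₂ heq.symm
    have hδz : δ = 0 := by
      have : δ ^ 2 = 0 := by rw [hδ2]; linarith
      exact pow_eq_zero_iff (by norm_num) |>.mp this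
    have hder : ∀ τ, HasDerivAt (fun τ => τ * exp (-(k * τ))) ((1 - k * τ) * exp (-(k * τ))) τ := by
      intro τ
      have h1 : HasDerivAt (fun τ : ℝ => -(k * τ)) (-(k * 1)) τ :=
        ((hasDerivAt_id τ).const_mul k).neg
      refine HasDerivAt.congr_deriv ((hasDerivAt_id τ).mul h1.exp) ?_
      simp only [id]; ring
    have hder2 : ∀ τ, HasDerivAt (fun τ => (1 - k * τ) * exp (-(k * τ)))
        ((k ^ 2 * τ - 2 * k) * exp (-(k * τ))) τ := by
      intro τ
      have h0 : HasDerivAt (fun τ : ℝ => k * τ) (k * 1) τ := (hasDerivAt_id τ).const_mul k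
      refine HasDerivAt.congr_deriv ((h0.const_sub 1).mul h0.neg.exp) ?_
      simp only [Pi.neg_apply]; ring
    have hd1 := fun τ => (hder τ).deriv
    refine ds_core n c H b m2 β p κ μ R hc hH hβ hp hμ hR u0 u1 hu0s hu1s k 1 1 (min I0 I1)
      one_pos one_pos (lt_min hu0nt hu1nt) (fun τ => τ * exp (-(k * τ))) (fun t => 1 + t)
      ?_ ?_ ?_ ?_ ?_ ?_ ?_ ?_ ?_
    · fun_prop
    · simp
    · rw [hd1]; simp
    · intro τ
      rw [funext hd1, (hder2 τ).deriv, hb', hm', hδz]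
      ring
    · intro τ hτ; positivity
    · intro t ht; linarith
    · intro t ht
      rw [hd1, ← hI0, ← hI1]
      have he := Real.exp_pos (-(k * t))
      have h1 : min I0 I1 * (1 + t) ≤ t * I1 + (1 + k * t) * I0 := by
        have h2 := min_le_left I0 I1
        have h3 := min_le_right I0 I1
        have h4 : 0 ≤ k * t * I0 := by positivity
        nlinarith
      have := mul_le_mul_of_nonneg_left h1 he.le
      rw [hb', hδz]
      linarith
    · intro s hs
      rw [← Real.rpow_add (by linarith), hκ, ← Real.rpow_neg_one]
      congr 1; ring
    · intro s t η hs hη h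
      rw [one_mul, mul_one]
      apply mul_le_mul_of_nonneg_right _ (Real.exp_pos _).le
      have h1 : 1 + s ≤ (1 + t) * exp (-η) := by
        rw [Real.exp_neg, ← div_eq_mul_inv, le_div_iff₀ (Real.exp_pos _)]; exact h
      linarith

/-- **Theorem 3 (case with logarithmic growth).**
Blow-up and lifespan estimate for the semilinear wave equation in de Sitter spacetime when
`Γ(t) = μ e^{r_crit t}(1+t)^{κ_crit}` with `r_crit = ½(b−√(b²−4m²))((β+1)p−1)` and
`κ_crit = −1` if `b² > 4m²`, `κ_crit = −1−(β+1)p` if `b² = 4m²`. The lifespan satisfies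
`T(ε) ≤ C exp(K ε^{−((β+1)p−1)})`. -/
theorem deSitter_blowup_logarithmic_growth
    (n : ℕ) (hn : 1 ≤ n) (c H b m2 β p κ μ R : ℝ)
    (hc : 0 < c) (hH : 0 < H) (hb : 0 ≤ b) (hm2 : 0 ≤ m2) (hdom : 4 * m2 ≤ b ^ 2)
    (hβ : 0 ≤ β) (hp : 1 < p)
    (hκ₁ : 4 * m2 < b ^ 2 → κ = -1)
    (hκ₂ : b ^ 2 = 4 * m2 → κ = -1 - (β + 1) * p)
    (hμ : 0 < μ) (hR : 0 < R)
    (u0 u1 : Eucl n → ℝ)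
    (hu0 : ∀ x, 0 ≤ u0 x) (hu1 : ∀ x, 0 ≤ u1 x)
    (hu0i : Integrable u0) (hu1i : Integrable u1)
    (hu0s : ∀ x, u0 x ≠ 0 → ‖x‖ ≤ R) (hu1s : ∀ x, u1 x ≠ 0 → ‖x‖ ≤ R)
    (hu0nt : 0 < ∫ x, u0 x) (hu1nt : 0 < ∫ x, u1 x) :
    ∃ ε₀ > 0, ∃ C > 0, ∃ K > 0, ∀ ε : ℝ, 0 < ε → ε ≤ ε₀ →
      -- the weak solution blows up in finite time: there is no global-in-time weak solution
      (¬ ∃ u ut : ℝ → Eucl n → ℝ, ∀ T : ℝ, 0 < T →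
          IsWeakSolDS n c H b m2 p β
            (fun t => μ * exp (((1/2) * (b - Real.sqrt (b ^ 2 - 4 * m2))
              * ((β + 1) * p - 1)) * t) * (1 + t) ^ κ) ε u0 u1 R T u ut) ∧
      -- upper bound estimate for the lifespan
      (∀ T : ℝ, 0 < T → ∀ u ut : ℝ → Eucl n → ℝ,
        IsWeakSolDS n c H b m2 p β
          (fun t => μ * exp (((1/2) * (b - Real.sqrt (b ^ 2 - 4 * m2))
            * ((β + 1) * p - 1)) * t) * (1 + t) ^ κ) ε u0 u1 R T u ut →
        T ≤ C * exp (K * ε ^ (-((β + 1) * p - 1)))) := by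
  obtain ⟨K, hK, h⟩ := ds_bound n c H b m2 β p κ μ R hc hH hb hm2 hdom hβ hp hκ₁ hκ₂ hμ hR u0 u1
    hu0s hu1s hu0nt hu1nt
  refine ⟨1, one_pos, 1, one_pos, K, hK, fun ε hε hε1 => ⟨?_, ?_⟩⟩
  · rintro ⟨u, ut, hu⟩
    have hE := Real.exp_pos (K * ε ^ (-((β + 1) * p - 1)))
    have := h ε hε hε1 (exp (K * ε ^ (-((β + 1) * p - 1))) + 1) (by linarith) u ut
      (hu _ (by linarith))
    linarith
  · intro T hT u ut hu
    rw [one_mul]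
    exact h ε hε hε1 T hT u ut hu
end
end
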